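/- arXiv:2110.03957 — 5 statements merged into one kernel-verified Lean document; each statement's English description precedes it below -/
import Mathlib

section
/- For every positive integer n and every simple graph G on n vertices, the twin-width of G is strictly less than (n + √(n ln n) + √n + 2 ln n)/2. -/
/-- A trigraph: a finite vertex set together with disjoint symmetric sets of
black and red edges on distinct vertices. -/
structure Trigraph (V : Type*) where
  verts : Finset V
  Black : V → V → Prop
  Red : V → V → Prop
  black_symm : ∀ u v, Black u v → Black v u
  red_symm : ∀ u v, Red u v → Red v u
  black_ne : ∀ u v, Black u v → u ≠ v
  red_ne : ∀ u v, Red u v → u ≠ v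
  black_red_disjoint : ∀ u v, ¬(Black u v ∧ Red u v)
  black_mem : ∀ u v, Black u v → u ∈ verts
  red_mem : ∀ u v, Red u v → u ∈ verts

namespace Trigraph

variable {V : Type*}

/-- Two vertices are adjacent if they are joined by a black or a red edge. -/
def Adj (G : Trigraph V) (u v : V) : Prop := G.Black u v ∨ G.Red u v

/-- The red-degree of a vertex: the number of red edges incident with it. -/
noncomputable def redDeg (G : Trigraph V) (v : V) : ℕ := {w | G.Red v w}.ncard

/-- The degree of a vertex: the number of (black or red) edges incident with it. -/
noncomputable def deg (G : Trigraph V) (v : V) : ℕ := {w | G.Adj v w}.ncard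

/-- Contraction of the two distinct vertices `u` and `v` of `G`; the new vertex is
identified with `u`. A pair keeps a black edge to the new vertex iff it had black
edges to both `u` and `v`; it is non-adjacent iff it was non-adjacent to both;
otherwise it gets a red edge. -/
def contract [DecidableEq V] (G : Trigraph V) (u v : V) : Trigraph V where
  verts := G.verts.erase v
  Black x y := x ∈ G.verts.erase v ∧ y ∈ G.verts.erase v ∧ x ≠ y ∧
    ((x = u ∧ G.Black u y ∧ G.Black v y) ∨
     (y = u ∧ G.Black u x ∧ G.Black v x) ∨
     (x ≠ u ∧ y ≠ u ∧ G.Black x y))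
  Red x y := x ∈ G.verts.erase v ∧ y ∈ G.verts.erase v ∧ x ≠ y ∧
    ((x = u ∧ (G.Adj u y ∨ G.Adj v y) ∧ ¬(G.Black u y ∧ G.Black v y)) ∨
     (y = u ∧ (G.Adj u x ∨ G.Adj v x) ∧ ¬(G.Black u x ∧ G.Black v x)) ∨
     (x ≠ u ∧ y ≠ u ∧ G.Red x y))
  black_symm := by
    rintro x y ⟨hx, hy, hxy, h⟩
    refine ⟨hy, hx, hxy.symm, ?_⟩
    rcases h with h | h | ⟨h1, h2, h3⟩
    · exact Or.inr (Or.inl h)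
    · exact Or.inl h
    · exact Or.inr (Or.inr ⟨h2, h1, G.black_symm _ _ h3⟩)
  red_symm := by
    rintro x y ⟨hx, hy, hxy, h⟩
    refine ⟨hy, hx, hxy.symm, ?_⟩
    rcases h with h | h | ⟨h1, h2, h3⟩
    · exact Or.inr (Or.inl h)
    · exact Or.inl h
    · exact Or.inr (Or.inr ⟨h2, h1, G.red_symm _ _ h3⟩)
  black_ne := fun _ _ h => h.2.2.1
  red_ne := fun _ _ h => h.2.2.1
  black_red_disjoint := by
    rintro x y ⟨⟨hx, hy, hxy, hb⟩, ⟨_, _, _, hr⟩⟩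
    rcases hb with ⟨hxu, hb1, hb2⟩ | ⟨hyu, hb1, hb2⟩ | ⟨hxu, hyu, hb⟩ <;>
      rcases hr with ⟨hxu', hr1, hr2⟩ | ⟨hyu', hr1, hr2⟩ | ⟨hxu', hyu', hr⟩
    · exact hr2 ⟨hb1, hb2⟩
    · exact hxy (hxu.trans hyu'.symm)
    · exact hxu' hxu
    · exact hxy (hxu'.trans hyu.symm)
    · exact hr2 ⟨hb1, hb2⟩
    · exact hyu' hyu
    · exact hxu hxu'
    · exact hyu hyu'
    · exact G.black_red_disjoint x y ⟨hb, hr⟩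
  black_mem := fun _ _ h => h.1
  red_mem := fun _ _ h => h.1

/-- `G.ValidSeq L` asserts that the list `L` of pairs of vertices describes a
sequence of valid contractions starting from `G`: at each step, both vertices are
distinct vertices of the current trigraph, which are then contracted. -/
def ValidSeq [DecidableEq V] : Trigraph V → List (V × V) → Prop
  | _, [] => True
  | G, p :: L => p.1 ∈ G.verts ∧ p.2 ∈ G.verts ∧ p.1 ≠ p.2 ∧ ValidSeq (G.contract p.1 p.2) L

/-- The trigraph obtained after performing the contractions listed in `L`. -/
def applySeq [DecidableEq V] (G : Trigraph V) (L : List (V × V)) : Trigraph V :=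
  L.foldl (fun H p => H.contract p.1 p.2) G

/-- The twin-width of a trigraph: the least `d` admitting a contraction sequence to a
one-vertex trigraph in which every intermediate trigraph has maximum red-degree at most `d`. -/
noncomputable def tww [DecidableEq V] (G : Trigraph V) : ℕ :=
  sInf {d : ℕ | ∃ L : List (V × V), G.ValidSeq L ∧ (G.applySeq L).verts.card = 1 ∧
    ∀ L' : List (V × V), L' <+: L → ∀ v, (G.applySeq L').redDeg v ≤ d}

/-- The map induced by a partial contraction sequence, sending each vertex of the
initial trigraph to the vertex of the final trigraph into which it is contracted. -/
def seqMap [DecidableEq V] (L : List (V × V)) (x : V) : V :=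
  L.foldl (fun y p => if y = p.2 then p.1 else y) x

/-- `δ_G(A)`: the set of edges of `G` with one end in `A` and the other end not in `A`. -/
def cut (G : Trigraph V) (A : Set V) : Set (Sym2 V) :=
  {e | ∃ x y, e = s(x, y) ∧ G.Adj x y ∧ x ∈ A ∧ y ∉ A}

end Trigraph

/-- A simple graph viewed as a trigraph with all edges black and no red edges. -/
def SimpleGraph.toTrigraph {V : Type*} [Fintype V] (G : SimpleGraph V) : Trigraph V where
  verts := Finset.univ
  Black := G.Adj
  Red _ _ := False
  black_symm := fun _ _ h => h.symm
  red_symm := fun _ _ h => h.elim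
  black_ne := fun _ _ h => h.ne
  red_ne := fun _ _ h => h.elim
  black_red_disjoint := fun _ _ h => h.2
  black_mem := fun _ _ _ => Finset.mem_univ _
  red_mem := fun _ _ h => h.elim

/-- The twin-width of a simple graph. -/
noncomputable def SimpleGraph.tww {V : Type*} [Fintype V] [DecidableEq V]
    (G : SimpleGraph V) : ℕ :=
  G.toTrigraph.tww

open Finset

/-- reflection potential -/
noncomputable def phi (P Q b : ℕ) : ℝ :=
  if b ≤ P then ((P + Q).choose (P - b) : ℝ) / ((P + Q).choose P : ℝ) else 0

lemma phi_nonneg (P Q b : ℕ) : 0 ≤ phi P Q b := by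
  unfold phi; split_ifs <;> positivity

lemma phi_zero (P Q : ℕ) : phi P Q 0 = 1 := by
  unfold phi
  have : ((P + Q).choose P : ℝ) ≠ 0 := by
    exact_mod_cast (Nat.choose_pos (Nat.le_add_right P Q)).ne'
  simp [this]

lemma phi_step (P Q b : ℕ) :
    (P : ℝ) * phi (P - 1) Q b + Q * phi P (Q - 1) (b + 2) ≤ (P + Q : ℝ) * phi P Q (b + 1) := by
  rcases Nat.eq_zero_or_pos P with rfl | hP
  · simp [phi]
  obtain ⟨P, rfl⟩ : ∃ p, P = p + 1 := ⟨P - 1, by omega⟩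
  by_cases hb : b ≤ P
  swap
  · have h1 : ¬ (b ≤ P + 1 - 1) := by omega
    have h2 : ¬ (b + 2 ≤ P + 1) := by omega
    have h3 : ¬ (b + 1 ≤ P + 1) := by omega
    simp only [phi, if_neg h1, if_neg h2, if_neg h3]; simp
  have hC : (0:ℝ) < ((P + 1 + Q).choose (P + 1) : ℝ) := by
    exact_mod_cast Nat.choose_pos (Nat.le_add_right _ _)
  have e1 : ((P + 1 : ℕ) : ℝ) * phi (P + 1 - 1) Q b
      = (P + 1 + Q : ℝ) * ((P + Q).choose (P - b) : ℝ) / ((P + 1 + Q).choose (P + 1) : ℝ) := by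
    have hC' : (0:ℝ) < ((P + Q).choose P : ℝ) := by
      exact_mod_cast Nat.choose_pos (Nat.le_add_right _ _)
    have h := Nat.add_one_mul_choose_eq (P + Q) P
    have h' : ((P + Q + 1 : ℝ)) * ((P + Q).choose P : ℝ)
        = ((P + 1 + Q).choose (P + 1) : ℝ) * (P + 1) := by
      have : P + 1 + Q = P + Q + 1 := by omega
      rw [this]; exact_mod_cast h
    simp only [phi, Nat.add_sub_cancel, if_pos hb]
    push_cast
    field_simp
    linear_combination (-((P + Q).choose (P - b) : ℝ)) * h'
  have e2 : (Q : ℝ) * phi (P + 1) (Q - 1) (b + 2)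
      ≤ (P + 1 + Q : ℝ) * (if b + 1 ≤ P then ((P + Q).choose (P - (b + 1)) : ℝ) else 0)
        / ((P + 1 + Q).choose (P + 1) : ℝ) := by
    rcases Nat.eq_zero_or_pos Q with rfl | hQ
    · simp only [Nat.cast_zero, zero_mul]
      split_ifs <;> positivity
    obtain ⟨Q, rfl⟩ : ∃ p, Q = p + 1 := ⟨Q - 1, by omega⟩
    by_cases h2 : b + 1 ≤ P
    swap
    · have h3 : ¬ (b + 2 ≤ P + 1) := by omega
      simp [phi, h2, h3]
    have h3 : b + 2 ≤ P + 1 := by omega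
    simp only [phi, if_pos h2, if_pos h3]
    have a1 : P + 1 + (Q + 1 - 1) = P + (Q + 1) := by omega
    have a2 : P + 1 - (b + 2) = P - (b + 1) := by omega
    rw [a1, a2]
    have hC' : (0:ℝ) < ((P + (Q + 1)).choose (P + 1) : ℝ) := by
      exact_mod_cast Nat.choose_pos (by omega)
    have h := Nat.choose_mul_succ_eq (P + (Q + 1)) (P + 1)
    have a3 : P + (Q + 1) + 1 - (P + 1) = Q + 1 := by omega
    rw [a3] at h
    have a4 : P + (Q + 1) + 1 = P + 1 + (Q + 1) := by omega
    rw [a4] at h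
    have h' : ((P + (Q + 1)).choose (P + 1) : ℝ) * (P + 1 + (Q + 1))
      = ((P + 1 + (Q + 1)).choose (P + 1) : ℝ) * (Q + 1) := by exact_mod_cast h
    apply le_of_eq
    push_cast
    field_simp
    linear_combination (-((P + (Q + 1)).choose (P - (b + 1)) : ℝ)) * h'
  have e3 : ((P + 1 : ℕ) + Q : ℝ) * phi (P + 1) Q (b + 1)
      = (P + 1 + Q : ℝ) * ((P + 1 + Q).choose (P - b) : ℝ) / ((P + 1 + Q).choose (P + 1) : ℝ) := by
    have : b + 1 ≤ P + 1 := by omega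
    have a : P + 1 - (b + 1) = P - b := by omega
    simp only [phi, if_pos this, a]
    push_cast; ring
  have pas : ((P + 1 + Q).choose (P - b) : ℝ) = ((P + Q).choose (P - b) : ℝ)
      + (if b + 1 ≤ P then ((P + Q).choose (P - (b + 1)) : ℝ) else 0) := by
    split_ifs with h
    · obtain ⟨k, hk⟩ : ∃ k, P - b = k + 1 := ⟨P - b - 1, by omega⟩
      have hk' : P - (b + 1) = k := by omega
      have a4 : P + 1 + Q = P + Q + 1 := by omega
      rw [hk, hk', a4, Nat.choose_succ_succ]; push_cast; ring
    · have : P - b = 0 := by omega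
      simp [this]
  rw [e1, e3, pas, mul_add, add_div]
  linarith

lemma choose_exp (M J : ℕ) : ∀ A : ℕ, 2 * (J + A) ≤ M →
    (M.choose J : ℝ) * Real.exp (2 * ((A : ℝ) * ((M : ℝ) - 2 * J - A)) / (M + 1))
      ≤ (M.choose (J + A) : ℝ) := by
  intro A
  induction A with
  | zero => intro _; simp
  | succ A ih =>
    intro h
    have ih := ih (by omega)
    set L := J + A with hL
    have hM : (2 * (L + 1) : ℝ) ≤ M := by exact_mod_cast (by omega : 2 * (L + 1) ≤ M)
    have hLr : (L : ℝ) = J + A := by rw [hL]; push_cast; ring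
    have h1 := Nat.choose_succ_right_eq M L
    have h1' : (M.choose (L + 1) : ℝ) * (L + 1) = (M.choose L : ℝ) * (M - L) := by
      have := congrArg (Nat.cast (R := ℝ)) h1
      rw [Nat.cast_mul, Nat.cast_mul, Nat.cast_sub (by omega)] at this
      push_cast at this; exact this
    have hL1 : (0:ℝ) < L + 1 := by positivity
    have h2 : Real.exp (2 * ((M : ℝ) - 2 * L - 1) / (M + 1)) ≤ ((M : ℝ) - L) / (L + 1) := by
      have hz : 0 ≤ ((M : ℝ) - 2 * L - 1) / (L + 1) := div_nonneg (by linarith) hL1.le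
      have h3 := Real.le_log_one_add_of_nonneg hz
      have h4 : 1 + ((M : ℝ) - 2 * L - 1) / (L + 1) = ((M : ℝ) - L) / (L + 1) := by
        field_simp; ring
      have h5 : 2 * (((M : ℝ) - 2 * L - 1) / (L + 1)) / (((M : ℝ) - 2 * L - 1) / (L + 1) + 2)
          = 2 * ((M : ℝ) - 2 * L - 1) / (M + 1) := by
        have : ((M : ℝ) - 2 * L - 1) / (L + 1) + 2 = (M + 1) / (L + 1) := by
          field_simp; ring
        rw [this]; field_simp
      rw [h4, h5] at h3
      have hpos : 0 < ((M : ℝ) - L) / (L + 1) := div_pos (by linarith) hL1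
      calc _ ≤ Real.exp (Real.log (((M : ℝ) - L) / (L + 1))) := Real.exp_le_exp.2 h3
        _ = _ := Real.exp_log hpos
    have e : 2 * (((A + 1 : ℕ) : ℝ) * ((M : ℝ) - 2 * J - (A + 1 : ℕ))) / (M + 1)
        = 2 * ((A : ℝ) * ((M : ℝ) - 2 * J - A)) / (M + 1) + 2 * ((M : ℝ) - 2 * L - 1) / (M + 1) := by
      rw [hLr]; push_cast; field_simp; ring
    rw [e, Real.exp_add, ← mul_assoc, ← add_assoc]
    calc _ ≤ (M.choose L : ℝ) * (((M : ℝ) - L) / (L + 1)) :=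
          mul_le_mul ih h2 (Real.exp_pos _).le (by positivity)
      _ = _ := by rw [← mul_div_assoc, ← h1', mul_div_assoc, div_self hL1.ne', mul_one]

lemma phi_le (P Q b : ℕ) (h : P ≤ Q + b) :
    phi P Q b ≤ Real.exp (-(2 * ((b : ℝ) * ((b : ℝ) - P + Q)) / (P + Q + 1))) := by
  unfold phi
  split_ifs with hb
  swap
  · positivity
  have hC : (0:ℝ) < ((P + Q).choose P : ℝ) := by
    exact_mod_cast Nat.choose_pos (Nat.le_add_right _ _)
  rw [div_le_iff₀ hC, Real.exp_neg, ← div_eq_inv_mul, le_div_iff₀ (Real.exp_pos _)]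
  obtain ⟨J, rfl⟩ : ∃ J, P = J + b := ⟨P - b, by omega⟩
  rcases le_total (J + b) Q with hPQ | hPQ
  · have := choose_exp (J + b + Q) J b (by omega)
    simp only [Nat.add_sub_cancel]
    convert this using 2
    congr 1; push_cast; ring_nf
  · have := choose_exp (J + b + Q) J (Q - J) (by omega)
    have e : J + (Q - J) = Q := by omega
    rw [e, Nat.cast_sub (by omega)] at this
    have e2 : (J + b + Q).choose (J + b) = (J + b + Q).choose Q := Nat.choose_symm_add
    simp only [Nat.add_sub_cancel]
    rw [e2]
    convert this using 2
    congr 1; push_cast; ring_nf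

def Trigraph.Good {V : Type*} [DecidableEq V] (d : ℕ) (H : Trigraph V) : Prop :=
  ∃ L : List (V × V), H.ValidSeq L ∧ (H.applySeq L).verts.card = 1 ∧
    ∀ L' : List (V × V), L' <+: L → ∀ v, (H.applySeq L').redDeg v ≤ d

lemma Trigraph.Good.step {V : Type*} [DecidableEq V] {d : ℕ} {H : Trigraph V} {u v : V}
    (hu : u ∈ H.verts) (hv : v ∈ H.verts) (huv : u ≠ v) (hd : ∀ x, H.redDeg x ≤ d)
    (h : (H.contract u v).Good d) : H.Good d := by
  obtain ⟨L, h1, h2, h3⟩ := h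
  refine ⟨(u, v) :: L, ⟨hu, hv, huv, h1⟩, h2, ?_⟩
  intro L' hL'
  cases L' with
  | nil => exact hd
  | cons p L' =>
    rw [List.cons_prefix_cons] at hL'
    obtain ⟨rfl, hL'⟩ := hL'
    exact h3 L' hL'

lemma Trigraph.redDeg_lt {V : Type*} [DecidableEq V] (H : Trigraph V) (x : V) (hx : x ∈ H.verts) :
    H.redDeg x + 1 ≤ H.verts.card := by
  unfold Trigraph.redDeg
  have : {w | H.Red x w} ⊆ ((H.verts.erase x : Finset V) : Set V) := by
    intro w hw
    have hw : H.Red x w := hw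
    simp only [coe_erase, Set.mem_sdiff, mem_coe, Set.mem_singleton_iff]
    exact ⟨H.red_mem _ _ (H.red_symm _ _ hw), (H.red_ne _ _ hw).symm⟩
  have h := Set.ncard_le_ncard this (Finset.finite_toSet _)
  rw [Set.ncard_coe_finset] at h
  have := Finset.card_erase_add_one hx
  omega

lemma Trigraph.redDeg_zero {V : Type*} (H : Trigraph V) (x : V) (hx : x ∉ H.verts) :
    H.redDeg x = 0 := by
  unfold Trigraph.redDeg
  have : {w | H.Red x w} = ∅ := by
    ext w
    simp only [Set.mem_ofPred_eq, Set.mem_empty_iff_false, iff_false]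
    exact fun h => hx (H.red_mem _ _ h)
  rw [this]; simp

lemma Trigraph.good_of_card {V : Type*} [DecidableEq V] (d : ℕ) : ∀ (k : ℕ) (H : Trigraph V),
    H.verts.card = k + 1 → k ≤ d → H.Good d := by
  intro k
  have key : ∀ (k : ℕ) (H : Trigraph V), H.verts.card = k + 1 → k ≤ d →
      ∀ x, H.redDeg x ≤ d := by
    intro k H hk hd x
    by_cases hx : x ∈ H.verts
    · have := H.redDeg_lt x hx; omega
    · rw [H.redDeg_zero x hx]; omega
  induction k with
  | zero =>
    intro H h hd
    refine ⟨[], trivial, h, ?_⟩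
    intro L' hL'
    rw [List.prefix_nil] at hL'
    subst hL'
    exact key 0 H h hd
  | succ k ih =>
    intro H h hd
    obtain ⟨u, hu, v, hv, huv⟩ := Finset.one_lt_card.1 (by omega : 1 < H.verts.card)
    refine Trigraph.Good.step hu hv huv (key _ H h hd) (ih _ ?_ (by omega))
    change (H.verts.erase v).card = _
    rw [Finset.card_erase_of_mem hv]; omega

section
variable {V : Type*} [Fintype V] [DecidableEq V]

open Classical in
noncomputable def Dset (G : SimpleGraph V) (w : V × V) : Finset V :=
  univ.filter (fun x => x ≠ w.1 ∧ x ≠ w.2 ∧ ¬ (G.Adj w.1 x ↔ G.Adj w.2 x))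

lemma mem_Dset (G : SimpleGraph V) (w : V × V) (x : V) :
    x ∈ Dset G w ↔ x ≠ w.1 ∧ x ≠ w.2 ∧ ¬ (G.Adj w.1 x ↔ G.Adj w.2 x) := by
  simp [Dset]

def Unt (S : Finset (V × V)) (x : V) : Prop := ∀ p ∈ S, x ≠ p.1 ∧ x ≠ p.2

structure IsMatch (M : Finset (V × V)) : Prop where
  ne : ∀ p ∈ M, p.1 ≠ p.2
  disj : ∀ p ∈ M, ∀ q ∈ M, p ≠ q → p.1 ≠ q.1 ∧ p.1 ≠ q.2 ∧ p.2 ≠ q.1 ∧ p.2 ≠ q.2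

structure MInv (G : SimpleGraph V) (S : Finset (V × V)) (H : Trigraph V) : Prop where
  verts : ∀ x, x ∈ H.verts ↔ ∀ p ∈ S, x ≠ p.2
  nored : ∀ x y, Unt S x → Unt S y → ¬ H.Red x y
  black : ∀ x y, Unt S x → Unt S y → (H.Black x y ↔ G.Adj x y)
  red : ∀ p ∈ S, ∀ x, Unt S x → H.Red p.1 x → x ∈ Dset G p

lemma IsMatch.unt {M S : Finset (V × V)} (hM : IsMatch M) (hS : S ⊆ M) {p : V × V}
    (hp : p ∈ M) (hpS : p ∉ S) : Unt S p.1 ∧ Unt S p.2 := by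
  constructor
  · intro q hq
    have := hM.disj p hp q (hS hq) (by rintro rfl; exact hpS hq)
    exact ⟨this.1, this.2.1⟩
  · intro q hq
    have := hM.disj p hp q (hS hq) (by rintro rfl; exact hpS hq)
    exact ⟨this.2.2.1, this.2.2.2⟩

lemma unt_insert (S : Finset (V × V)) (p : V × V) (x : V) :
    Unt (insert p S) x ↔ Unt S x ∧ x ≠ p.1 ∧ x ≠ p.2 := by
  simp only [Unt, Finset.forall_mem_insert]; tauto

lemma MInv.init (G : SimpleGraph V) : MInv G ∅ G.toTrigraph where
  verts := by simp [SimpleGraph.toTrigraph]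
  nored := by intro x y _ _ h; exact h
  black := by intro x y _ _; rfl
  red := by simp

lemma MInv.step {G : SimpleGraph V} {M S : Finset (V × V)} {H : Trigraph V} (hM : IsMatch M)
    (hS : S ⊆ M) {p : V × V} (hp : p ∈ M) (hpS : p ∉ S) (h : MInv G S H) :
    MInv G (insert p S) (H.contract p.1 p.2) where
  verts := by
    intro x
    change x ∈ H.verts.erase p.2 ↔ _
    rw [Finset.mem_erase, h.verts, Finset.forall_mem_insert]
  nored := by
    intro x y hx hy hr
    rw [unt_insert] at hx hy
    obtain ⟨_, _, _, hr⟩ := hr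
    rcases hr with hr | hr | hr
    · exact hx.2.1 hr.1
    · exact hy.2.1 hr.1
    · exact h.nored x y hx.1 hy.1 hr.2.2
  black := by
    intro x y hx hy
    rw [unt_insert] at hx hy
    rw [← h.black x y hx.1 hy.1]
    constructor
    · rintro ⟨_, _, _, hr⟩
      rcases hr with hr | hr | hr
      · exact (hx.2.1 hr.1).elim
      · exact (hy.2.1 hr.1).elim
      · exact hr.2.2
    · intro hb
      refine ⟨?_, ?_, H.black_ne _ _ hb, Or.inr (Or.inr ⟨hx.2.1, hy.2.1, hb⟩)⟩
      · exact Finset.mem_erase.2 ⟨hx.2.2, H.black_mem _ _ hb⟩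
      · exact Finset.mem_erase.2 ⟨hy.2.2, H.black_mem _ _ (H.black_symm _ _ hb)⟩
  red := by
    intro q hq x hx hr
    rw [unt_insert] at hx
    obtain ⟨hp1, hp2⟩ := hM.unt hS hp hpS
    obtain ⟨_, _, _, hr⟩ := hr
    rcases Finset.mem_insert.1 hq with rfl | hq
    · rcases hr with hr | hr | hr
      · rw [mem_Dset]
        refine ⟨hx.2.1, hx.2.2, ?_⟩
        obtain ⟨_, hr1, hr2⟩ := hr
        have n1 := h.nored _ _ hp1 hx.1
        have n2 := h.nored _ _ hp2 hx.1
        simp only [Trigraph.Adj] at hr1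
        rw [← h.black _ _ hp1 hx.1, ← h.black _ _ hp2 hx.1]
        tauto
      · exact (hx.2.1 hr.1).elim
      · exact (hr.1 rfl).elim
    · rcases hr with hr | hr | hr
      · exact ((hp1 q hq).1 hr.1.symm).elim
      · exact (hx.2.1 hr.1).elim
      · exact h.red q hq x hx.1 hr.2.2

open Classical in
noncomputable def TT (G : SimpleGraph V) (S : Finset (V × V)) (w : V × V) : ℕ :=
  (S.erase w).card + ((Dset G w).filter (Unt S)).card

open Classical in
noncomputable def PP (G : SimpleGraph V) (M S : Finset (V × V)) (w : V × V) : Finset (V × V) :=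
  (M \ S).filter (fun p => p ≠ w ∧ p.1 ∉ Dset G w ∧ p.2 ∉ Dset G w)

open Classical in
noncomputable def QQ (G : SimpleGraph V) (M S : Finset (V × V)) (w : V × V) : Finset (V × V) :=
  (M \ S).filter (fun p => p ≠ w ∧ p.1 ∈ Dset G w ∧ p.2 ∈ Dset G w)

lemma redDeg_le {G : SimpleGraph V} {M S : Finset (V × V)} {H : Trigraph V} {d : ℕ}
    (hS : S ⊆ M) (h : MInv G S H)
    (hd : S.card ≤ d) (hT : ∀ w ∈ M, TT G S w ≤ d) (x : V) : H.redDeg x ≤ d := by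
  classical
  by_cases hxv : x ∈ H.verts
  swap
  · rw [H.redDeg_zero x hxv]; omega
  by_cases hx : Unt S x
  · have : {w | H.Red x w} ⊆ ((S.image Prod.fst : Finset V) : Set V) := by
      intro y hy
      have hy : H.Red x y := hy
      by_contra hc
      refine h.nored x y hx ?_ hy
      intro p hp
      refine ⟨?_, (h.verts y).1 (H.red_mem _ _ (H.red_symm _ _ hy)) p hp⟩
      rintro rfl
      exact hc (by simpa using ⟨p.2, hp⟩)
    have h1 := Set.ncard_le_ncard this (Finset.finite_toSet _)
    rw [Set.ncard_coe_finset] at h1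
    have := Finset.card_image_le (s := S) (f := Prod.fst)
    unfold Trigraph.redDeg
    omega
  · obtain ⟨w, hw, hxw⟩ : ∃ w ∈ S, x = w.1 := by
      simp only [Unt, not_forall] at hx
      obtain ⟨p, hp, hx⟩ := hx
      refine ⟨p, hp, ?_⟩
      have := (h.verts x).1 hxv p hp
      tauto
    subst hxw
    have : {y | H.Red w.1 y} ⊆
        (((S.erase w).image Prod.fst ∪ (Dset G w).filter (Unt S) : Finset V) : Set V) := by
      intro y hy
      have hy : H.Red w.1 y := hy
      rw [Finset.mem_coe, Finset.mem_union]
      by_cases hu : Unt S y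
      · right
        rw [Finset.mem_filter]
        exact ⟨h.red w hw y hu hy, hu⟩
      · left
        simp only [Unt, not_forall] at hu
        obtain ⟨p, hp, hu⟩ := hu
        have := (h.verts y).1 (H.red_mem _ _ (H.red_symm _ _ hy)) p hp
        have hyp : y = p.1 := by tauto
        rw [Finset.mem_image]
        refine ⟨p, Finset.mem_erase.2 ⟨?_, hp⟩, hyp.symm⟩
        rintro rfl
        exact H.red_ne _ _ hy hyp.symm
    have h1 := Set.ncard_le_ncard this (Finset.finite_toSet _)
    rw [Set.ncard_coe_finset] at h1
    have h2 := Finset.card_image_le (s := S.erase w) (f := Prod.fst)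
    have h3 := Finset.card_union_le ((S.erase w).image Prod.fst) ((Dset G w).filter (Unt S))
    have h4 := hT w (hS hw)
    unfold TT at h4
    unfold Trigraph.redDeg
    omega

lemma PP_insert (G : SimpleGraph V) (M S : Finset (V × V)) (w p : V × V) :
    PP G M (insert p S) w = (PP G M S w).erase p := by
  ext q; simp only [PP, mem_filter, mem_sdiff, mem_insert, mem_erase]; tauto

lemma QQ_insert (G : SimpleGraph V) (M S : Finset (V × V)) (w p : V × V) :
    QQ G M (insert p S) w = (QQ G M S w).erase p := by
  ext q; simp only [QQ, mem_filter, mem_sdiff, mem_insert, mem_erase]; tauto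

lemma TT_insert {G : SimpleGraph V} {M S : Finset (V × V)} (hM : IsMatch M)
    (hS : S ⊆ M) {p w : V × V} (hp : p ∈ M) (hpS : p ∉ S) :
    TT G (insert p S) w + ((if p.1 ∈ Dset G w then 1 else 0) + (if p.2 ∈ Dset G w then 1 else 0))
      = TT G S w + (if p = w then 0 else 1) := by
  classical
  obtain ⟨hp1, hp2⟩ := hM.unt hS hp hpS
  have hne := hM.ne p hp
  have e : (Dset G w).filter (Unt (insert p S))
      = (((Dset G w).filter (Unt S)).erase p.1).erase p.2 := by
    ext x; simp only [mem_filter, mem_erase, unt_insert]; tauto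
  have c1 : (((Dset G w).filter (Unt (insert p S)))).card
      + ((if p.1 ∈ Dset G w then 1 else 0) + (if p.2 ∈ Dset G w then 1 else 0))
      = ((Dset G w).filter (Unt S)).card := by
    rw [e, Finset.card_erase_eq_ite, Finset.card_erase_eq_ite]
    have m1 : p.1 ∈ (Dset G w).filter (Unt S) ↔ p.1 ∈ Dset G w := by
      simp [hp1]
    have m2 : p.2 ∈ ((Dset G w).filter (Unt S)).erase p.1 ↔ p.2 ∈ Dset G w := by
      simp [hp2, hne.symm]
    simp only [m1, m2]
    have : p.1 ∈ Dset G w → 1 ≤ ((Dset G w).filter (Unt S)).card := fun h =>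
      Finset.card_pos.2 ⟨_, m1.2 h⟩
    have : p.2 ∈ Dset G w → 1 ≤ ((Dset G w).filter (Unt S)).card := fun h =>
      Finset.card_pos.2 ⟨_, Finset.mem_of_mem_erase (m2.2 h)⟩
    have : p.1 ∈ Dset G w → p.2 ∈ Dset G w → 2 ≤ ((Dset G w).filter (Unt S)).card := fun h h' =>
      Finset.one_lt_card.2 ⟨_, m1.2 h, _, Finset.mem_of_mem_erase (m2.2 h'), hne⟩
    split_ifs <;> simp_all <;> omega
  have c2 : ((insert p S).erase w).card = (S.erase w).card + (if p = w then 0 else 1) := by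
    split_ifs with hpw
    · subst hpw
      rw [Finset.erase_insert hpS, Finset.erase_eq_of_notMem hpS]; rfl
    · rw [Finset.erase_insert_of_ne hpw, Finset.card_insert_of_notMem]
      simp [hpS]
  unfold TT
  omega

lemma avg {G : SimpleGraph V} {M S : Finset (V × V)} (hM : IsMatch M)
    (hS : S ⊆ M) {w : V × V} {β : ℕ} (hT : TT G S w < β) :
    ∑ p ∈ M \ S, phi (PP G M (insert p S) w).card (QQ G M (insert p S) w).card
      (β - TT G (insert p S) w)
    ≤ ((M \ S).card : ℝ) * phi (PP G M S w).card (QQ G M S w).card (β - TT G S w) := by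
  classical
  obtain ⟨c, hc⟩ : ∃ c, β - TT G S w = c + 1 := ⟨β - TT G S w - 1, by omega⟩
  set P := PP G M S w with hP
  set Q := QQ G M S w with hQ
  set x := phi (P.card - 1) Q.card c
  set y := phi P.card (Q.card - 1) (c + 2)
  set z := phi P.card Q.card (c + 1) with hz
  have hPs : P ⊆ M \ S := Finset.filter_subset _ _
  have hQs : Q ⊆ M \ S := Finset.filter_subset _ _
  have term : ∀ p ∈ M \ S, phi (PP G M (insert p S) w).card (QQ G M (insert p S) w).card
      (β - TT G (insert p S) w)
      = z + ((if p ∈ P then x - z else 0) + (if p ∈ Q then y - z else 0)) := by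
    intro p hp
    have hpm := Finset.mem_sdiff.1 hp
    have hTT := TT_insert (G := G) (w := w) hM hS hpm.1 hpm.2
    rw [PP_insert, QQ_insert, ← hP, ← hQ]
    have mP : p ∈ P ↔ (p ≠ w ∧ p.1 ∉ Dset G w ∧ p.2 ∉ Dset G w) := by
      simp only [hP, PP, mem_filter, hp, true_and]
    have mQ : p ∈ Q ↔ (p ≠ w ∧ p.1 ∈ Dset G w ∧ p.2 ∈ Dset G w) := by
      simp only [hQ, QQ, mem_filter, hp, true_and]
    by_cases h1 : p ∈ P
    · have h1' := mP.1 h1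
      have h2 : p ∉ Q := by rw [mQ]; tauto
      rw [if_neg h1'.2.1, if_neg h1'.2.2, if_neg h1'.1] at hTT
      rw [if_pos h1, if_neg h2, Finset.card_erase_of_mem h1, Finset.erase_eq_of_notMem h2]
      have : β - TT G (insert p S) w = c := by omega
      rw [this]; ring
    · by_cases h2 : p ∈ Q
      · have h2' := mQ.1 h2
        rw [if_pos h2'.2.1, if_pos h2'.2.2, if_neg h2'.1] at hTT
        rw [if_neg h1, if_pos h2, Finset.card_erase_of_mem h2, Finset.erase_eq_of_notMem h1]
        have : β - TT G (insert p S) w = c + 2 := by omega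
        rw [this]; ring
      · rw [if_neg h1, if_neg h2, Finset.erase_eq_of_notMem h1, Finset.erase_eq_of_notMem h2]
        have : TT G (insert p S) w = TT G S w := by
          by_cases hpw : p = w
          · have a1 : p.1 ∉ Dset G w := by rw [mem_Dset, hpw]; simp
            have a2 : p.2 ∉ Dset G w := by rw [mem_Dset, hpw]; simp
            rw [if_neg a1, if_neg a2, if_pos hpw] at hTT
            omega
          · rw [if_neg hpw] at hTT
            rw [mP] at h1
            rw [mQ] at h2
            split_ifs at hTT with b1 b2 b2
            · exact (h2 ⟨hpw, b1, b2⟩).elim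
            · omega
            · omega
            · exact (h1 ⟨hpw, b1, b2⟩).elim
        rw [this, hc]; ring
  rw [Finset.sum_congr rfl term, Finset.sum_add_distrib, Finset.sum_add_distrib,
    Finset.sum_ite_mem, Finset.sum_ite_mem, Finset.inter_eq_right.2 hPs,
    Finset.inter_eq_right.2 hQs, Finset.sum_const, Finset.sum_const, Finset.sum_const, hc]
  simp only [nsmul_eq_mul]
  have := phi_step P.card Q.card c
  change (P.card : ℝ) * x + Q.card * y ≤ (P.card + Q.card : ℝ) * z at this
  linarith

noncomputable def Phi (G : SimpleGraph V) (M S : Finset (V × V)) (β : ℕ) : ℝ :=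
  ∑ w ∈ M, phi (PP G M S w).card (QQ G M S w).card (β - TT G S w)

lemma TT_lt_of_Phi {G : SimpleGraph V} {M S : Finset (V × V)} {β : ℕ} (h : Phi G M S β < 1)
    {w : V × V} (hw : w ∈ M) : TT G S w < β := by
  by_contra hc
  have h0 : β - TT G S w = 0 := by omega
  have h1 := Finset.single_le_sum (s := M)
    (f := fun w => phi (PP G M S w).card (QQ G M S w).card (β - TT G S w))
    (fun i _ => phi_nonneg _ _ _) hw
  simp only [h0, phi_zero] at h1
  unfold Phi at h
  linarith

lemma good_of_Phi {G : SimpleGraph V} {M : Finset (V × V)} {β : ℕ} (hM : IsMatch M)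
    (hMβ : M.card < β) (hV : Fintype.card V ≤ M.card + β) (hpos : 0 < Fintype.card V) :
    ∀ (k : ℕ) (S : Finset (V × V)) (H : Trigraph V), S ⊆ M → (M \ S).card = k → MInv G S H →
      Phi G M S β < 1 → H.Good (β - 1) := by
  classical
  intro k
  induction k with
  | zero =>
    intro S H hS hk hI hPhi
    have hSM : S = M := by
      apply Finset.Subset.antisymm hS
      rw [← Finset.sdiff_eq_empty_iff_subset]; exact Finset.card_eq_zero.1 hk
    subst hSM
    have hv : H.verts = univ \ S.image Prod.snd := by
      ext x
      rw [hI.verts]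
      simp only [mem_sdiff, mem_univ, true_and, mem_image, not_exists, not_and]
      exact forall_congr' fun p => forall_congr' fun _ => ne_comm
    have hcard : (S.image Prod.snd).card = S.card := by
      apply Finset.card_image_of_injOn
      intro p hp q hq hpq
      by_contra hne
      exact (hM.disj p hp q hq hne).2.2.2 hpq
    have hc : H.verts.card = Fintype.card V - S.card := by
      rw [hv, Finset.card_sdiff_of_subset (Finset.subset_univ _), hcard, Finset.card_univ]
    have hne : 0 < H.verts.card := by
      rw [Finset.card_pos]
      by_cases hS0 : S = ∅
      · subst hS0
        obtain ⟨x⟩ := Fintype.card_pos_iff.1 hpos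
        exact ⟨x, (hI.verts x).2 (by simp)⟩
      · obtain ⟨p, hp⟩ := Finset.nonempty_iff_ne_empty.2 hS0
        refine ⟨p.1, (hI.verts _).2 ?_⟩
        intro q hq
        by_cases hpq : p = q
        · subst hpq; exact hM.ne p hp
        · exact (hM.disj p hp q hq hpq).2.1
    exact Trigraph.good_of_card _ (H.verts.card - 1) H (by omega) (by omega)
  | succ k ih =>
    intro S H hS hk hI hPhi
    have hTT : ∀ w ∈ M, TT G S w < β := fun w hw => TT_lt_of_Phi hPhi hw
    obtain ⟨p, hp, hle⟩ : ∃ p ∈ M \ S, Phi G M (insert p S) β ≤ Phi G M S β := by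
      apply Finset.exists_le_of_sum_le
      · exact Finset.card_pos.1 (by omega)
      · unfold Phi
        rw [Finset.sum_comm, Finset.sum_const, nsmul_eq_mul, Finset.mul_sum]
        exact Finset.sum_le_sum fun w hw => avg hM hS (hTT w hw)
    obtain ⟨hpM, hpS⟩ := Finset.mem_sdiff.1 hp
    have hrd : ∀ x, H.redDeg x ≤ β - 1 := by
      refine redDeg_le hS hI ?_ ?_
      · have := Finset.card_le_card hS; omega
      · intro w hw; have := hTT w hw; omega
    obtain ⟨u1, u2⟩ := hM.unt hS hpM hpS
    refine Trigraph.Good.step ((hI.verts _).2 fun q hq => (u1 q hq).2)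
      ((hI.verts _).2 fun q hq => (u2 q hq).2) (hM.ne p hpM) hrd ?_
    refine ih (insert p S) _ (Finset.insert_subset hpM hS) ?_ (hI.step hM hS hpM hpS)
      (lt_of_le_of_lt hle hPhi)
    rw [Finset.sdiff_insert, Finset.card_erase_of_mem hp]; omega

end

section
variable {V : Type*} [Fintype V] [DecidableEq V]

lemma sum_Dset_le (G : SimpleGraph V) (A : Finset V) :
    2 * ∑ u ∈ A, ∑ v ∈ A, ((Dset G (u, v)).card : ℤ) ≤ (Fintype.card V : ℤ) * (A.card : ℤ) ^ 2 := by
  classical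
  let e : V → V → ℤ := fun x u => if G.Adj u x then 1 else 0
  have h1 : ∀ u v, ((Dset G (u, v)).card : ℤ) ≤ ∑ x : V, (e x u - e x v) ^ 2 := by
    intro u v
    rw [Dset, Finset.card_filter]
    push_cast
    apply Finset.sum_le_sum
    intro x _
    simp only [e]
    by_cases a : G.Adj u x <;> by_cases b : G.Adj v x <;> simp [a, b] <;> split_ifs <;> simp
  have h2 : ∑ u ∈ A, ∑ v ∈ A, ((Dset G (u, v)).card : ℤ)
      ≤ ∑ x : V, ∑ u ∈ A, ∑ v ∈ A, (e x u - e x v) ^ 2 := by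
    calc _ ≤ ∑ u ∈ A, ∑ v ∈ A, ∑ x : V, (e x u - e x v) ^ 2 :=
          Finset.sum_le_sum fun u _ => Finset.sum_le_sum fun v _ => h1 u v
      _ = ∑ u ∈ A, ∑ x : V, ∑ v ∈ A, (e x u - e x v) ^ 2 :=
          Finset.sum_congr rfl fun u _ => Finset.sum_comm
      _ = _ := Finset.sum_comm
  have h3 : ∀ x : V, 2 * ∑ u ∈ A, ∑ v ∈ A, (e x u - e x v) ^ 2 ≤ (A.card : ℤ) ^ 2 := by
    intro x
    have hsq : ∀ u, e x u ^ 2 = e x u := by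
      intro u; simp only [e]; split_ifs <;> simp
    have : ∑ u ∈ A, ∑ v ∈ A, (e x u - e x v) ^ 2
        = 2 * A.card * (∑ u ∈ A, e x u) - 2 * (∑ u ∈ A, e x u) ^ 2 := by
      have : ∀ u v, (e x u - e x v) ^ 2 = e x u + e x v - 2 * (e x u * e x v) := by
        intro u v
        have a := hsq u
        have b := hsq v
        linear_combination a + b
      simp only [this, Finset.sum_sub_distrib, Finset.sum_add_distrib, Finset.sum_const,
        ← Finset.mul_sum, ← Finset.sum_mul, nsmul_eq_mul]
      ring
    rw [this]
    nlinarith [sq_nonneg ((A.card : ℤ) - 2 * ∑ u ∈ A, e x u)]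
  calc _ ≤ 2 * ∑ x : V, ∑ u ∈ A, ∑ v ∈ A, (e x u - e x v) ^ 2 := by linarith
    _ = ∑ x : V, 2 * ∑ u ∈ A, ∑ v ∈ A, (e x u - e x v) ^ 2 := by rw [Finset.mul_sum]
    _ ≤ ∑ x : V, (A.card : ℤ) ^ 2 := Finset.sum_le_sum fun x _ => h3 x
    _ = _ := by simp

lemma exists_pair (G : SimpleGraph V) (A : Finset V) (m : ℕ) (hm : 1 ≤ m) (hA : A.card = m + 1) :
    ∃ u ∈ A, ∃ v ∈ A, u ≠ v ∧ 2 * m * (Dset G (u, v)).card ≤ Fintype.card V * (m + 1) := by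
  by_contra! hc
  have h := sum_Dset_le G A
  set n := Fintype.card V
  have h1 : ∀ u ∈ A, (m : ℤ) * (n * (m + 1) + 1)
      ≤ 2 * m * ∑ v ∈ A, ((Dset G (u, v)).card : ℤ) := by
    intro u hu
    have h2 : ∑ v ∈ A.erase u, ((n : ℤ) * (m + 1) + 1)
        ≤ ∑ v ∈ A.erase u, 2 * m * ((Dset G (u, v)).card : ℤ) := by
      apply Finset.sum_le_sum
      intro v hv
      obtain ⟨hv1, hv2⟩ := Finset.mem_erase.1 hv
      have := hc u hu v hv2 hv1.symm
      exact_mod_cast this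
    rw [Finset.sum_const, Finset.card_erase_of_mem hu, hA, nsmul_eq_mul] at h2
    rw [Finset.mul_sum]
    refine le_trans ?_ (h2.trans (Finset.sum_le_sum_of_subset_of_nonneg
      (Finset.erase_subset _ _) fun _ _ _ => by positivity))
    simp
  have h2 := Finset.sum_le_sum h1
  rw [Finset.sum_const, hA, nsmul_eq_mul, ← Finset.mul_sum] at h2
  rw [hA] at h
  push_cast at h h2
  have hm' : (1 : ℤ) ≤ m := by exact_mod_cast hm
  nlinarith

lemma exists_match (G : SimpleGraph V) (m : ℕ) (hm : 1 ≤ m) : ∀ (k : ℕ) (A : Finset V),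
    A.card = k → ∃ M : Finset (V × V), IsMatch M ∧ (∀ p ∈ M, p.1 ∈ A ∧ p.2 ∈ A) ∧
      (∀ p ∈ M, 2 * m * (Dset G p).card ≤ Fintype.card V * (m + 1)) ∧ k ≤ 2 * M.card + m := by
  intro k
  induction k using Nat.strong_induction_on with
  | _ k ih =>
    intro A hA
    by_cases hk : k ≤ m
    · exact ⟨∅, ⟨by simp, by simp⟩, by simp, by simp, by simpa using hk⟩
    obtain ⟨B, hBA, hB⟩ := Finset.exists_subset_card_eq (s := A) (n := m + 1) (by omega)
    obtain ⟨u, hu, v, hv, huv, hD⟩ := exists_pair G B m hm hB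
    have hvA : v ∈ A.erase u := Finset.mem_erase.2 ⟨huv.symm, hBA hv⟩
    have hc : ((A.erase u).erase v).card = k - 2 := by
      rw [Finset.card_erase_of_mem hvA, Finset.card_erase_of_mem (hBA hu)]; omega
    obtain ⟨M, h1, h2, h3, h4⟩ := ih (k - 2) (by omega) _ hc
    have h2' : ∀ p ∈ M, (p.1 ≠ u ∧ p.1 ≠ v ∧ p.1 ∈ A) ∧ (p.2 ≠ u ∧ p.2 ≠ v ∧ p.2 ∈ A) := by
      intro p hp
      have := h2 p hp
      simp only [Finset.mem_erase] at this
      tauto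
    have hnot : (u, v) ∉ M := fun h => (h2' _ h).1.1 rfl
    refine ⟨insert (u, v) M, ⟨?_, ?_⟩, ?_, ?_, ?_⟩
    · intro p hp
      rcases Finset.mem_insert.1 hp with rfl | hp
      · exact huv
      · exact h1.ne p hp
    · intro p hp q hq hpq
      rcases Finset.mem_insert.1 hp with rfl | hp <;> rcases Finset.mem_insert.1 hq with rfl | hq
      · exact (hpq rfl).elim
      · have := h2' q hq
        exact ⟨this.1.1.symm, this.2.1.symm, this.1.2.1.symm, this.2.2.1.symm⟩
      · have := h2' p hp
        exact ⟨this.1.1, this.1.2.1, this.2.1, this.2.2.1⟩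
      · exact h1.disj p hp q hq hpq
    · intro p hp
      rcases Finset.mem_insert.1 hp with rfl | hp
      · exact ⟨hBA hu, hBA hv⟩
      · exact ⟨(h2' p hp).1.2.2, (h2' p hp).2.2.2⟩
    · intro p hp
      rcases Finset.mem_insert.1 hp with rfl | hp
      · exact hD
      · exact h3 p hp
    · rw [Finset.card_insert_of_notMem hnot]; omega

lemma match_cover {M : Finset (V × V)} (hM : IsMatch M) :
    (M.image Prod.fst ∪ M.image Prod.snd).card = 2 * M.card := by
  rw [Finset.card_union_of_disjoint, Finset.card_image_of_injOn, Finset.card_image_of_injOn]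
  · omega
  · intro p hp q hq hpq
    by_contra hne
    exact (hM.disj p hp q hq hne).2.2.2 hpq
  · intro p hp q hq hpq
    by_contra hne
    exact (hM.disj p hp q hq hne).1 hpq
  · rw [Finset.disjoint_left]
    intro x hx hy
    obtain ⟨p, hp, rfl⟩ := Finset.mem_image.1 hx
    obtain ⟨q, hq, hqp⟩ := Finset.mem_image.1 hy
    by_cases hpq : p = q
    · subst hpq; exact hM.ne p hp hqp.symm
    · exact (hM.disj p hp q hq hpq).2.1 hqp.symm

lemma match_card {M : Finset (V × V)} (hM : IsMatch M) : 2 * M.card ≤ Fintype.card V := by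
  rw [← match_cover hM]; exact Finset.card_le_univ _

lemma PQ_card {G : SimpleGraph V} {M : Finset (V × V)} {w : V × V} (hw : w ∈ M) :
    (PP G M ∅ w).card + (QQ G M ∅ w).card + 1 ≤ M.card := by
  classical
  have hd : Disjoint (PP G M ∅ w) (QQ G M ∅ w) := by
    rw [Finset.disjoint_left]
    intro p h1 h2
    simp only [PP, QQ, mem_filter] at h1 h2
    tauto
  rw [← Finset.card_union_of_disjoint hd, ← Finset.card_erase_add_one hw]
  refine Nat.add_le_add_right (Finset.card_le_card ?_) 1
  intro p hp
  simp only [PP, QQ, mem_union, mem_filter, mem_sdiff] at hp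
  rw [Finset.mem_erase]; tauto

lemma D_card {G : SimpleGraph V} {M : Finset (V × V)} (hM : IsMatch M) {w : V × V} (hw : w ∈ M) :
    (Dset G w).card + (PP G M ∅ w).card + M.card + 1 ≤ Fintype.card V + (QQ G M ∅ w).card := by
  classical
  have hsub : Dset G w ⊆ (univ \ (M.image Prod.fst ∪ M.image Prod.snd)) ∪
      (((M.erase w).filter (fun p => p.1 ∈ Dset G w)).image Prod.fst ∪
       ((M.erase w).filter (fun p => p.2 ∈ Dset G w)).image Prod.snd) := by
    intro x hx
    have hx' := (mem_Dset G w x).1 hx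
    by_cases h1 : ∃ p ∈ M, p.1 = x
    · obtain ⟨p, hp, rfl⟩ := h1
      refine Finset.mem_union_right _ (Finset.mem_union_left _ (Finset.mem_image.2 ⟨p, ?_, rfl⟩))
      rw [Finset.mem_filter, Finset.mem_erase]
      exact ⟨⟨by rintro rfl; exact hx'.1 rfl, hp⟩, hx⟩
    by_cases h2 : ∃ p ∈ M, p.2 = x
    · obtain ⟨p, hp, rfl⟩ := h2
      refine Finset.mem_union_right _ (Finset.mem_union_right _ (Finset.mem_image.2 ⟨p, ?_, rfl⟩))
      rw [Finset.mem_filter, Finset.mem_erase]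
      exact ⟨⟨by rintro rfl; exact hx'.2.1 rfl, hp⟩, hx⟩
    apply Finset.mem_union_left
    rw [Finset.mem_sdiff, Finset.mem_union, Finset.mem_image, Finset.mem_image]
    exact ⟨Finset.mem_univ _, fun h => h.elim h1 h2⟩
  have c1 := Finset.card_le_card hsub
  have c2 := Finset.card_union_le (univ \ (M.image Prod.fst ∪ M.image Prod.snd))
      (((M.erase w).filter (fun p => p.1 ∈ Dset G w)).image Prod.fst ∪
       ((M.erase w).filter (fun p => p.2 ∈ Dset G w)).image Prod.snd)
  have c3 := Finset.card_union_le (((M.erase w).filter (fun p => p.1 ∈ Dset G w)).image Prod.fst)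
       (((M.erase w).filter (fun p => p.2 ∈ Dset G w)).image Prod.snd)
  have c4 := Finset.card_image_le (s := (M.erase w).filter (fun p => p.1 ∈ Dset G w))
    (f := Prod.fst)
  have c5 := Finset.card_image_le (s := (M.erase w).filter (fun p => p.2 ∈ Dset G w))
    (f := Prod.snd)
  have c6 : (univ \ (M.image Prod.fst ∪ M.image Prod.snd)).card = Fintype.card V - 2 * M.card := by
    rw [Finset.card_sdiff_of_subset (Finset.subset_univ _), match_cover hM, Finset.card_univ]
  have c7 := match_card hM
  have eP : PP G M ∅ w = (M.erase w).filter (fun p => p.1 ∉ Dset G w ∧ p.2 ∉ Dset G w) := by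
    ext p; simp only [PP, mem_filter, mem_sdiff, mem_erase, notMem_empty]; tauto
  have eQ : QQ G M ∅ w = (M.erase w).filter (fun p => p.1 ∈ Dset G w ∧ p.2 ∈ Dset G w) := by
    ext p; simp only [QQ, mem_filter, mem_sdiff, mem_erase, notMem_empty]; tauto
  have c8 : (PP G M ∅ w).card + (((M.erase w).filter (fun p => p.1 ∈ Dset G w)).card +
      ((M.erase w).filter (fun p => p.2 ∈ Dset G w)).card)
      = (M.erase w).card + (QQ G M ∅ w).card := by
    rw [eP, eQ, Finset.card_filter, Finset.card_filter, Finset.card_filter, Finset.card_filter,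
      Finset.card_eq_sum_ones, ← Finset.sum_add_distrib, ← Finset.sum_add_distrib,
      ← Finset.sum_add_distrib]
    apply Finset.sum_congr rfl
    intro p _
    by_cases a : p.1 ∈ Dset G w <;> by_cases b : p.2 ∈ Dset G w <;> simp [a, b]
  have c9 := Finset.card_erase_add_one hw
  omega

end

/-- **Theorem 1.** For every positive integer `n` and every simple graph `G` on `n`
vertices, `tww(G) < (n + √(n ln n) + √n + 2 ln n)/2`. -/
theorem tww_lt_of_card_vertices {V : Type*} [Fintype V] [DecidableEq V]
    (n : ℕ) (hn : 0 < n) (hcard : Fintype.card V = n) (G : SimpleGraph V) :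
    (G.tww : ℝ) <
      ((n : ℝ) + Real.sqrt ((n : ℝ) * Real.log n) + Real.sqrt n + 2 * Real.log n) / 2 := by

  classical
  have hn1 : (1 : ℝ) ≤ n := by exact_mod_cast hn
  have hn0 : (0 : ℝ) < n := by linarith
  have hlog : 0 ≤ Real.log n := Real.log_nonneg hn1
  set X : ℝ := ((n : ℝ) + Real.sqrt ((n : ℝ) * Real.log n) + Real.sqrt n + 2 * Real.log n) / 2
    with hX
  set τ : ℝ := Real.sqrt ((n : ℝ) * Real.log n) / 2 with hτ
  set s : ℝ := Real.sqrt n with hs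
  have hτ0 : 0 ≤ τ := by positivity
  have hs1 : 1 ≤ s := by rw [hs]; exact Real.one_le_sqrt.2 hn1
  have hss : s * s = n := Real.mul_self_sqrt hn0.le
  have hττ : 4 * (τ * τ) = n * Real.log n := by
    have := Real.mul_self_sqrt (mul_nonneg hn0.le hlog)
    rw [hτ]; linarith
  have hXτ : X = n / 2 + τ + s / 2 + Real.log n := by rw [hX, hτ]; ring
  clear_value X τ
  set m : ℕ := ⌈s⌉₊ with hm
  have hms : s ≤ m := Nat.le_ceil _
  have hm1 : 1 ≤ m := by
    have : (1 : ℝ) ≤ m := hs1.trans hms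
    exact_mod_cast this
  have hm2 : (m : ℝ) ≤ s + 2 * Real.log n := by
    rcases Nat.lt_or_ge n 2 with h | h
    · have h1 : n = 1 := by omega
      have : s = 1 := by rw [hs, h1]; simp
      have hm' : m = 1 := by rw [hm, this]; simp
      rw [hm', this]; push_cast; linarith
    · have h1 : Real.log 2 ≤ Real.log n :=
        Real.log_le_log (by norm_num) (by exact_mod_cast h)
      have h2 := Real.log_two_gt_d9
      have h3 := Nat.ceil_lt_add_one (by linarith : 0 ≤ s)
      rw [← hm] at h3
      linarith
  obtain ⟨M, hM, -, hD, hk⟩ := exists_match G m hm1 n univ (by rw [Finset.card_univ, hcard])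
  rw [hcard] at hD
  have hN := match_card hM
  rw [hcard] at hN
  have hN' : 2 * (M.card : ℝ) ≤ n := by exact_mod_cast hN
  have hk' : (n : ℝ) ≤ 2 * M.card + m := by exact_mod_cast hk
  set β : ℕ := ⌈X⌉₊ with hβ
  have hβX : X ≤ β := Nat.le_ceil _
  have hX0 : 0 < X := by rw [hXτ]; positivity
  have hβ0 : 0 < β := Nat.ceil_pos.2 hX0
  have hNβ : M.card < β := by
    have : (M.card : ℝ) < β := by linarith
    exact_mod_cast this
  have hVβ : Fintype.card V ≤ M.card + β := by
    rw [hcard]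
    have : (n : ℝ) ≤ M.card + β := by linarith
    exact_mod_cast this
  have hPhi : Phi G M ∅ β < 1 := by
    have hterm : ∀ w ∈ M, phi (PP G M ∅ w).card (QQ G M ∅ w).card (β - TT G ∅ w) ≤ 1 / n := by
      intro w hw
      have hTT : TT G ∅ w = (Dset G w).card := by
        unfold TT
        rw [Finset.filter_true_of_mem (fun x _ => by simp [Unt])]
        simp
      rw [hTT]
      have d1 := hD w hw
      have d2 := D_card (G := G) hM hw
      have d3 := PQ_card (G := G) hw
      rw [hcard] at d2
      set P := (PP G M ∅ w).card
      set Q := (QQ G M ∅ w).card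
      set D := (Dset G w).card
      set b := β - D with hb
      have d1' : 2 * (m : ℝ) * D ≤ n * (m + 1) := by exact_mod_cast d1
      have d2' : (D : ℝ) + P + M.card + 1 ≤ n + Q := by exact_mod_cast d2
      have d3' : (P : ℝ) + Q + 1 ≤ M.card := by exact_mod_cast d3
      have hm0 : (0 : ℝ) < m := by linarith
      have hDle : (D : ℝ) ≤ n / 2 + s / 2 := by
        have h1 : s * s ≤ s * m := mul_le_mul_of_nonneg_left hms (by linarith)
        rw [hss] at h1
        have h2 : (m : ℝ) * (2 * D) ≤ m * (n + s) := by
          calc (m : ℝ) * (2 * D) = 2 * m * D := by ring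
            _ ≤ n * (m + 1) := d1'
            _ = n * m + n := by ring
            _ ≤ n * m + s * m := by linarith only [h1]
            _ = m * (n + s) := by ring
        have h3 := le_of_mul_le_mul_left h2 hm0
        linarith only [h3]
      have hbge : (β : ℝ) - D ≤ b := by
        have : β ≤ b + D := by omega
        have : (β : ℝ) ≤ b + D := by exact_mod_cast this
        linarith
      have b1 : τ ≤ b := by linarith
      have b2 : τ ≤ b - P + Q := by linarith
      have hPQ : P ≤ Q + b := by
        have : (P : ℝ) ≤ Q + b := by linarith
        exact_mod_cast this
      refine (phi_le P Q b hPQ).trans ?_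
      have hexp : Real.log n ≤ 2 * ((b : ℝ) * (b - P + Q)) / (P + Q + 1) := by
        rw [le_div_iff₀ (by positivity)]
        have h1 : τ * τ ≤ (b : ℝ) * (b - P + Q) := mul_le_mul b1 b2 hτ0 (by linarith)
        have h2 : Real.log n * ((P : ℝ) + Q + 1) ≤ Real.log n * (n / 2) :=
          mul_le_mul_of_nonneg_left (by linarith) hlog
        linarith
      calc _ ≤ Real.exp (-Real.log n) := Real.exp_le_exp.2 (by linarith)
        _ = 1 / n := by rw [Real.exp_neg, Real.exp_log hn0, one_div]
    calc Phi G M ∅ β ≤ ∑ w ∈ M, (1 / n : ℝ) := Finset.sum_le_sum hterm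
      _ = M.card / n := by rw [Finset.sum_const, nsmul_eq_mul]; ring
      _ < 1 := by rw [div_lt_one hn0]; linarith
  have hgood := good_of_Phi hM hNβ hVβ (by omega) _ ∅ G.toTrigraph (by simp) rfl
    (MInv.init G) hPhi
  have hle : G.tww ≤ β - 1 := Nat.sInf_le hgood
  have hlt : G.tww < ⌈X⌉₊ := by omega
  exact Nat.lt_ceil.1 hlt
end

section
/- For every positive integer m and every simple graph G with exactly m edges, the twin-width of G is strictly less than √(3m) + m^{1/4}·√(ln m)/(4·3^{1/4}) + 3·m^{1/4}/2. -/
section Helpers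

open Finset

theorem num_ineq (D b m T s : ℕ) (hD : 2 ≤ D) (hb : D ≤ b) (hm : 3 * m ≤ D ^ 2)
    (hTs : T + 2 * s ≤ 2 * m) :
    ((2 * b - 1 : ℝ) * (T + s) - (T : ℝ) ^ 2 / b) < (D + 1) * b * (b - 1) := by
  have hD' : (2 : ℝ) ≤ D := by exact_mod_cast hD
  have hb' : (D : ℝ) ≤ b := by exact_mod_cast hb
  have hm' : 3 * (m : ℝ) ≤ (D : ℝ) ^ 2 := by exact_mod_cast hm
  have hTs' : (T : ℝ) + 2 * s ≤ 2 * m := by exact_mod_cast hTs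
  have hT0 : (0 : ℝ) ≤ T := by positivity
  have hs0 : (0 : ℝ) ≤ s := by positivity
  have hb0 : (0 : ℝ) < b := by linarith
  have h1 : (2 * b - 1 : ℝ) * (T + s) ≤ (2 * b - 1 : ℝ) * (T / 2 + m) :=
    mul_le_mul_of_nonneg_left (by linarith) (by linarith)
  rcases le_total (b : ℝ) (2 * D) with h | h
  · have h2 : (b : ℝ) * T - b ^ 3 / 4 ≤ (T : ℝ) ^ 2 / b := by
      rw [le_div_iff₀ hb0]
      nlinarith [sq_nonneg ((T : ℝ) - b ^ 2 / 2)]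
    have h3 : (2 * b - 1 : ℝ) * (T + s) - (T : ℝ) ^ 2 / b ≤ (2 * b - 1) * m + b ^ 3 / 4 := by
      nlinarith
    refine lt_of_le_of_lt h3 ?_
    rcases Nat.lt_or_ge D 3 with h5 | h5
    · have hDe : D = 2 := by omega
      subst hDe
      have hm1 : (m : ℝ) ≤ 1 := by
        have : m ≤ 1 := by omega
        exact_mod_cast this
      have hb4 : b ≤ 4 := by
        have : (b : ℝ) ≤ 4 := by push_cast at h; linarith
        exact_mod_cast this
      interval_cases b <;> norm_num <;> linarith
    · have h5' : (3 : ℝ) ≤ D := by exact_mod_cast h5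
      have h6 : (2 * b - 1 : ℝ) * m ≤ (2 * b - 1) * (D ^ 2 / 3) :=
        mul_le_mul_of_nonneg_left (by linarith) (by linarith)
      refine lt_of_le_of_lt (add_le_add_left h6 _) ?_
      obtain ⟨k, hk⟩ : ∃ k : ℝ, (b : ℝ) = D + k := ⟨b - D, by ring⟩
      obtain ⟨j, hj⟩ : ∃ j : ℝ, (D : ℝ) = 3 + j := ⟨D - 3, by ring⟩
      have hk0 : 0 ≤ k := by linarith
      have hkD : k ≤ D := by linarith
      have hj0 : 0 ≤ j := by linarith
      have h7 : k ^ 3 ≤ k ^ 2 * D := by nlinarith [sq_nonneg k]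
      rw [hk]
      have e : ((D : ℝ) + 1) * (D + k) * (D + k - 1) -
          ((2 * (D + k) - 1) * (D ^ 2 / 3) + (D + k) ^ 3 / 4) =
          (D ^ 3 / 12 + D ^ 2 / 3 - D) + k * (7 / 12 * D ^ 2 + D - 1)
            + (k ^ 2 * D / 4 + k ^ 2) - k ^ 3 / 4 := by ring
      have p1 : (0 : ℝ) < D ^ 3 / 12 + D ^ 2 / 3 - D := by
        rw [hj]; ring_nf; positivity
      have p2 : (0 : ℝ) ≤ k * (7 / 12 * D ^ 2 + D - 1) := by
        apply mul_nonneg hk0; nlinarith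
      nlinarith [sq_nonneg k]
  · have h2 : (0 : ℝ) ≤ (T : ℝ) ^ 2 / b := by positivity
    have h3 : (2 * b - 1 : ℝ) * (T / 2 + m) ≤ (2 * b - 1 : ℝ) * (2 * D ^ 2 / 3) :=
      mul_le_mul_of_nonneg_left (by linarith) (by linarith)
    have h4 : ((D : ℝ) + 1) * b * (2 * D - 1) ≤ (D + 1) * b * (b - 1) :=
      mul_le_mul_of_nonneg_left (by linarith) (by positivity)
    nlinarith [mul_pos hb0 (by linarith : (0 : ℝ) < D), mul_pos hb0 (by positivity : (0 : ℝ) < D ^ 2)]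

open Classical in
theorem exists_pair_s1 {V : Type*} [Fintype V] (A : V → V → Prop)
    (hA : ∀ x y, A x y → A y x) (D m : ℕ) (hD : 2 ≤ D) (hm : 3 * m ≤ D ^ 2)
    (hE : (univ.filter (fun p : V × V => A p.1 p.2)).card ≤ 2 * m)
    (B : Finset V) (hB : D ≤ B.card) :
    ∃ u ∈ B, ∃ v ∈ B, u ≠ v ∧
      (univ.filter (fun w => A u w ∨ A v w)).card ≤ D := by
  by_contra hcon
  push Not at hcon
  set b := B.card with hbdef
  let d : V → ℕ := fun w => (B.filter (fun u => A u w)).card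
  set T := ∑ w ∈ B, d w with hT
  set s := ∑ w ∈ Bᶜ, d w with hs
  have hsum : T + s = ∑ w, d w := Finset.sum_add_sum_compl B d
  have hN : ∑ u ∈ B, (univ.filter (fun w => A u w)).card = T + s := by
    rw [hsum]
    simp only [d, card_filter]
    rw [sum_comm]
  have hTs : T + 2 * s ≤ 2 * m := by
    refine le_trans ?_ hE
    have e1 : (univ.filter (fun p : V × V => A p.1 p.2)).card
        = ∑ u, (univ.filter (fun w => A u w)).card := by
      simp only [card_filter]
      rw [← univ_product_univ, sum_product]
    rw [e1, ← Finset.sum_add_sum_compl B, hN]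
    have e2 : s ≤ ∑ u ∈ Bᶜ, (univ.filter (fun w => A u w)).card := by
      apply sum_le_sum
      intro w _
      apply card_le_card
      intro u hu
      simp only [mem_filter, mem_univ, true_and] at hu ⊢
      exact hA _ _ hu.2
    omega
  have hpairs : ∀ w, ((((B ×ˢ B).filter (fun p => A p.1 w ∨ A p.2 w)).card : ℕ) : ℝ)
      = 2 * b * d w - (d w : ℝ) ^ 2 := by
    intro w
    have h1 := card_filter_add_card_filter_not (s := B ×ˢ B) (fun p => A p.1 w ∨ A p.2 w)
    have h2 : ((B ×ˢ B).filter (fun p => ¬ (A p.1 w ∨ A p.2 w)))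
        = (B.filter (fun u => ¬ A u w)) ×ˢ (B.filter (fun u => ¬ A u w)) := by
      ext ⟨x, y⟩
      simp only [mem_filter, mem_product]
      tauto
    have h3 := card_filter_add_card_filter_not (s := B) (fun u => A u w)
    rw [h2, card_product, card_product] at h1
    have h1' : ((((B ×ˢ B).filter (fun p => A p.1 w ∨ A p.2 w)).card : ℕ) : ℝ) +
      ((B.filter (fun u => ¬ A u w)).card : ℝ) * ((B.filter (fun u => ¬ A u w)).card : ℝ)
        = b * b := by exact_mod_cast h1
    have h3' : (d w : ℝ) + ((B.filter (fun u => ¬ A u w)).card : ℝ) = b := by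
      exact_mod_cast h3
    have h4 : ((B.filter (fun u => ¬ A u w)).card : ℝ) = b - d w := by linarith
    rw [h4] at h1'
    linarith
  have htot : ∑ p ∈ B ×ˢ B, (((univ.filter (fun w => A p.1 w ∨ A p.2 w)).card : ℕ) : ℝ)
      = ∑ w, (2 * b * d w - (d w : ℝ) ^ 2) := by
    rw [← sum_congr rfl (fun w _ => hpairs w)]
    simp only [card_filter]
    push_cast
    rw [sum_comm]
  have hlow : ((D : ℝ) + 1) * b * (b - 1) + (T + s) ≤
      ∑ p ∈ B ×ˢ B, (((univ.filter (fun w => A p.1 w ∨ A p.2 w)).card : ℕ) : ℝ) := by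
    rw [← diag_union_offDiag, sum_union (disjoint_diag_offDiag B)]
    have a1 : ∑ p ∈ B.diag, (((univ.filter (fun w => A p.1 w ∨ A p.2 w)).card : ℕ) : ℝ)
        = T + s := by
      rw [sum_diag]
      simp only [or_self]
      exact_mod_cast hN
    have a2 : ∑ _p ∈ B.offDiag, ((D : ℝ) + 1) ≤
        ∑ p ∈ B.offDiag, (((univ.filter (fun w => A p.1 w ∨ A p.2 w)).card : ℕ) : ℝ) := by
      apply sum_le_sum
      rintro ⟨x, y⟩ hp
      rw [mem_offDiag] at hp
      have := hcon x hp.1 y hp.2.1 hp.2.2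
      exact_mod_cast this
    have a3 : ∑ _p ∈ B.offDiag, ((D : ℝ) + 1) = ((D : ℝ) + 1) * b * (b - 1) := by
      rw [sum_const, offDiag_card, nsmul_eq_mul, Nat.cast_sub (Nat.le_mul_self _)]
      push_cast
      ring
    linarith
  have hsq : (T : ℝ) ^ 2 / b ≤ ∑ w, (d w : ℝ) ^ 2 := by
    have hb0 : (0 : ℝ) < b := by
      have : 0 < b := by omega
      exact_mod_cast this
    rw [div_le_iff₀ hb0]
    have c1 : (T : ℝ) ^ 2 ≤ b * ∑ w ∈ B, (d w : ℝ) ^ 2 := by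
      rw [hT]; push_cast
      exact sq_sum_le_card_mul_sum_sq
    have c2 : ∑ w ∈ B, (d w : ℝ) ^ 2 ≤ ∑ w, (d w : ℝ) ^ 2 :=
      sum_le_sum_of_subset_of_nonneg (subset_univ _) (fun _ _ _ => sq_nonneg _)
    nlinarith
  have hS : (∑ w, (d w : ℝ)) = T + s := by exact_mod_cast hsum.symm
  rw [htot, sum_sub_distrib, ← mul_sum, hS] at hlow
  have := num_ineq D b m T s hD hB hm hTs
  linarith

namespace Trigraph

variable {V : Type*}

theorem adj_symm (H : Trigraph V) {x y : V} (h : H.Adj x y) : H.Adj y x :=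
  h.elim (fun h => Or.inl (H.black_symm _ _ h)) (fun h => Or.inr (H.red_symm _ _ h))

theorem contract_adj [DecidableEq V] (H : Trigraph V) (u v a b : V)
    (h : (H.contract u v).Adj a b) :
    ∃ a' b', (if a' = v then u else a') = a ∧ (if b' = v then u else b') = b ∧ H.Adj a' b' := by
  have key : (a ≠ v ∧ b ≠ v) ∧ ((a = u ∧ (H.Adj u b ∨ H.Adj v b)) ∨
      (b = u ∧ (H.Adj u a ∨ H.Adj v a)) ∨ H.Adj a b) := by
    rcases h with h | h
    · obtain ⟨h1, h2, -, h⟩ := h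
      refine ⟨⟨Finset.ne_of_mem_erase h1, Finset.ne_of_mem_erase h2⟩, ?_⟩
      unfold Adj
      tauto
    · obtain ⟨h1, h2, -, h⟩ := h
      refine ⟨⟨Finset.ne_of_mem_erase h1, Finset.ne_of_mem_erase h2⟩, ?_⟩
      have : H.Red a b → H.Adj a b := Or.inr
      tauto
  obtain ⟨⟨ha, hb⟩, h⟩ := key
  rcases h with ⟨rfl, h | h⟩ | ⟨rfl, h | h⟩ | h
  · exact ⟨a, b, by simp [ha], by simp [hb], h⟩
  · exact ⟨v, b, by simp, by simp [hb], h⟩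
  · exact ⟨a, b, by simp [ha], by simp [hb], H.adj_symm h⟩
  · exact ⟨a, v, by simp [ha], by simp, H.adj_symm h⟩
  · exact ⟨a, b, by simp [ha], by simp [hb], h⟩

open Classical in
/-- The invariant kept by the contraction process. -/
def Inv [Fintype V] (H : Trigraph V) (B : Finset V) (D m : ℕ) : Prop :=
  B ⊆ H.verts ∧ B.card ≤ D ∧ (∀ x y, H.Red x y → x ∈ B ∨ y ∈ B) ∧
  (∀ x ∈ B, (univ.filter (fun w => H.Adj x w)).card ≤ D) ∧
  (univ.filter (fun p : V × V => H.Adj p.1 p.2)).card ≤ 2 * m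

theorem Inv.redDeg_le [Fintype V] {H : Trigraph V} {B : Finset V} {D m : ℕ}
    (h : H.Inv B D m) (x : V) : H.redDeg x ≤ D := by
  classical
  obtain ⟨-, h2, h3, h4, -⟩ := h
  unfold redDeg
  by_cases hx : x ∈ B
  · refine le_trans ?_ (h4 x hx)
    rw [← Set.ncard_coe_finset]
    apply Set.ncard_le_ncard _ (Set.toFinite _)
    intro w hw
    simp only [coe_filter, mem_univ, true_and]
    exact Or.inr hw
  · refine le_trans ?_ h2
    rw [← Set.ncard_coe_finset]
    apply Set.ncard_le_ncard _ (Set.toFinite _)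
    intro w hw
    exact (h3 x w hw).resolve_left hx

theorem redDeg_le_of_card [Fintype V] [DecidableEq V] {H : Trigraph V} {D : ℕ}
    (h : H.verts.card ≤ D + 1) (x : V) : H.redDeg x ≤ D := by
  unfold redDeg
  by_cases hx : x ∈ H.verts
  · have : (H.verts.erase x).card ≤ D := by rw [card_erase_of_mem hx]; omega
    refine le_trans ?_ this
    rw [← Set.ncard_coe_finset]
    apply Set.ncard_le_ncard _ (Set.toFinite _)
    intro w hw
    have hw' : H.Red x w := hw
    exact mem_coe.2 (mem_erase.2 ⟨(H.red_ne _ _ hw').symm, H.red_mem _ _ (H.red_symm _ _ hw')⟩)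
  · have : {w | H.Red x w} = ∅ := by
      ext w
      simp only [Set.mem_setOf_eq, Set.mem_empty_iff_false, iff_false]
      exact fun hw => hx (H.red_mem _ _ hw)
    rw [this]; simp

theorem Inv.contract [Fintype V] [DecidableEq V] {H : Trigraph V} {B : Finset V} {D m : ℕ}
    (h : H.Inv B D m) {u v : V} (hu : u ∈ H.verts) (huv : u ≠ v)
    (hB : (insert u (B.erase v)).card ≤ D)
    (hdeg : ∀ S : Finset V, (∀ w ∈ S, H.Adj u w ∨ H.Adj v w) → S.card ≤ D) :
    (H.contract u v).Inv (insert u (B.erase v)) D m := by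
  classical
  obtain ⟨h1, h2, h3, h4, h5⟩ := h
  set f : V → V := fun y => if y = v then u else y with hf
  refine ⟨?_, hB, ?_, ?_, ?_⟩
  · intro x hx
    rcases mem_insert.1 hx with rfl | hx
    · exact mem_erase.2 ⟨huv, hu⟩
    · exact mem_erase.2 ⟨ne_of_mem_erase hx, h1 (mem_of_mem_erase hx)⟩
  · rintro x y ⟨hx, hy, hxy, hr⟩
    have hxv := ne_of_mem_erase hx
    have hyv := ne_of_mem_erase hy
    simp only [mem_insert, mem_erase]
    rcases hr with hr | hr | hr
    · exact Or.inl (Or.inl hr.1)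
    · exact Or.inr (Or.inl hr.1)
    · rcases h3 x y hr.2.2 with h | h
      · exact Or.inl (Or.inr ⟨hxv, h⟩)
      · exact Or.inr (Or.inr ⟨hyv, h⟩)
  · intro x hx
    by_cases hxu : x = u
    · subst hxu
      have : (univ.filter (fun w => (H.contract x v).Adj x w)) ⊆
          ((univ.filter (fun w => H.Adj x w ∨ H.Adj v w)).image f) := by
        intro w hw
        obtain ⟨a', b', ha, hb, hab⟩ := H.contract_adj x v x w (mem_filter.1 hw).2
        refine mem_image.2 ⟨b', ?_, hb⟩
        simp only [mem_filter, mem_univ, true_and]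
        by_cases hav : a' = v
        · subst hav; exact Or.inr hab
        · rw [if_neg hav] at ha; subst ha; exact Or.inl hab
      refine (card_le_card this).trans (card_image_le.trans ?_)
      exact hdeg _ (fun w hw => (mem_filter.1 hw).2)
    · have hxB : x ∈ B := by
        rcases mem_insert.1 hx with h | h
        · exact absurd h hxu
        · exact mem_of_mem_erase h
      have : (univ.filter (fun w => (H.contract u v).Adj x w)) ⊆
          ((univ.filter (fun w => H.Adj x w)).image f) := by
        intro w hw
        obtain ⟨a', b', ha, hb, hab⟩ := H.contract_adj u v x w (mem_filter.1 hw).2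
        refine mem_image.2 ⟨b', ?_, hb⟩
        simp only [mem_filter, mem_univ, true_and]
        by_cases hav : a' = v
        · rw [if_pos hav] at ha; exact absurd ha.symm hxu
        · rw [if_neg hav] at ha; subst ha; exact hab
      exact (card_le_card this).trans (card_image_le.trans (h4 x hxB))
  · have : (univ.filter (fun p : V × V => (H.contract u v).Adj p.1 p.2)) ⊆
        ((univ.filter (fun p : V × V => H.Adj p.1 p.2)).image (Prod.map f f)) := by
      rintro ⟨x, y⟩ hw
      obtain ⟨a', b', ha, hb, hab⟩ := H.contract_adj u v x y (mem_filter.1 hw).2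
      refine mem_image.2 ⟨(a', b'), ?_, ?_⟩
      · simpa using hab
      · exact Prod.ext ha hb
    exact (card_le_card this).trans (card_image_le.trans h5)

theorem exists_seq [Fintype V] [DecidableEq V] (D m : ℕ) (hD : 2 ≤ D) (hm : 3 * m ≤ D ^ 2) :
    ∀ (n : ℕ) (H : Trigraph V), H.verts.card = n + 1 →
      (H.verts.card ≤ D + 1 ∨ ∃ B, H.Inv B D m) →
      ∃ L : List (V × V), H.ValidSeq L ∧ (H.applySeq L).verts.card = 1 ∧
        ∀ L' : List (V × V), L' <+: L → ∀ v, (H.applySeq L').redDeg v ≤ D := by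
  classical
  intro n
  induction n with
  | zero =>
    intro H hc _
    refine ⟨[], trivial, hc, ?_⟩
    intro L' hL' v
    rw [List.prefix_nil] at hL'
    subst hL'
    exact redDeg_le_of_card (H := H) (by omega) v
  | succ n ih =>
    intro H hc hI
    have hred : ∀ v, H.redDeg v ≤ D := by
      rcases hI with h | ⟨B, h⟩
      · exact redDeg_le_of_card h
      · exact h.redDeg_le
    have step : ∃ u ∈ H.verts, ∃ v ∈ H.verts, u ≠ v ∧
        ((H.contract u v).verts.card ≤ D + 1 ∨ ∃ B, (H.contract u v).Inv B D m) := by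
      by_cases hs : H.verts.card ≤ D + 1
      · obtain ⟨u, hu, v, hv, huv⟩ := one_lt_card.1 (by omega : 1 < H.verts.card)
        exact ⟨u, hu, v, hv, huv, Or.inl ((card_erase_le).trans hs)⟩
      · obtain ⟨B, hB⟩ := hI.resolve_left hs
        have hE := hB.2.2.2.2
        have hsym : ∀ x y, H.Adj x y → H.Adj y x := fun _ _ => H.adj_symm
        by_cases hb : B.card < D
        · obtain ⟨u, hu, v, hv, huv, hd⟩ := exists_pair_s1 H.Adj hsym D m hD hm hE H.verts (by omega)
          refine ⟨u, hu, v, hv, huv, Or.inr ⟨_, hB.contract hu huv ?_ ?_⟩⟩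
          · have h1 := card_insert_le u (B.erase v)
            have h2 : (B.erase v).card ≤ B.card := card_erase_le
            omega
          · intro S hS
            refine le_trans (card_le_card ?_) hd
            intro w hw
            exact mem_filter.2 ⟨mem_univ _, hS w hw⟩
        · obtain ⟨u, hu, v, hv, huv, hd⟩ := exists_pair_s1 H.Adj hsym D m hD hm hE B (by omega)
          refine ⟨u, hB.1 hu, v, hB.1 hv, huv, Or.inr ⟨_, hB.contract (hB.1 hu) huv ?_ ?_⟩⟩
          · refine le_trans (card_le_card ?_) hB.2.1
            intro x hx
            rcases mem_insert.1 hx with rfl | hx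
            · exact hu
            · exact mem_of_mem_erase hx
          · intro S hS
            refine le_trans (card_le_card ?_) hd
            intro w hw
            exact mem_filter.2 ⟨mem_univ _, hS w hw⟩
    obtain ⟨u, hu, v, hv, huv, hK⟩ := step
    have hKc : (H.contract u v).verts.card = n + 1 := by
      change (H.verts.erase v).card = n + 1
      rw [card_erase_of_mem hv]; omega
    obtain ⟨L, hL1, hL2, hL3⟩ := ih (H.contract u v) hKc hK
    refine ⟨(u, v) :: L, ⟨hu, hv, huv, hL1⟩, hL2, ?_⟩
    intro L' hL' x
    cases L' with
    | nil => exact hred x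
    | cons p L'' =>
      rw [List.cons_prefix_cons] at hL'
      obtain ⟨rfl, hL''⟩ := hL'
      exact hL3 L'' hL'' x

end Trigraph

theorem tww_le_nat {V : Type*} [Fintype V] [DecidableEq V]
    (m D : ℕ) (hm : 0 < m) (G : SimpleGraph V) (hedges : G.edgeSet.ncard = m)
    (hD : 2 ≤ D) (hmD : 3 * m ≤ D ^ 2) : G.tww ≤ D := by
  classical
  have hne : Nonempty V := by
    by_contra hcon
    rw [not_nonempty_iff] at hcon
    have : G.edgeSet = ∅ := by
      ext e
      induction e with
      | _ x y => exact hcon.elim x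
    rw [this] at hedges
    simp at hedges
    omega
  apply Nat.sInf_le
  obtain ⟨n, hn⟩ : ∃ n, Fintype.card V = n + 1 :=
    ⟨Fintype.card V - 1, by have := Fintype.card_pos (α := V); omega⟩
  refine Trigraph.exists_seq D m hD hmD n G.toTrigraph hn (Or.inr ⟨∅, ?_⟩)
  refine ⟨empty_subset _, by simp, fun x y h => h.elim, by simp, ?_⟩
  have hadj : ∀ x y, G.toTrigraph.Adj x y ↔ G.Adj x y := fun x y =>
    ⟨fun h => h.elim id (fun h => h.elim), Or.inl⟩
  simp only [hadj]
  have h1 : (univ.filter (fun p : V × V => G.Adj p.1 p.2)).card = ∑ v, G.degree v := by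
    simp only [← SimpleGraph.card_neighborFinset_eq_degree, SimpleGraph.neighborFinset_eq_filter,
      card_filter]
    rw [← univ_product_univ, sum_product]
  rw [h1, SimpleGraph.sum_degrees_eq_twice_card_edges, ← hedges,
    ← SimpleGraph.coe_edgeFinset, Set.ncard_coe_finset]

end Helpers

/-- **Theorem 2.** For every positive integer `m` and every simple graph `G` with `m`
edges, `tww(G) < √(3m) + m^{1/4}·√(ln m)/(4·3^{1/4}) + 3·m^{1/4}/2`. -/
theorem tww_lt_of_card_edges {V : Type*} [Fintype V] [DecidableEq V]
    (m : ℕ) (hm : 0 < m) (G : SimpleGraph V) (hedges : G.edgeSet.ncard = m) :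
    (G.tww : ℝ) <
      Real.sqrt (3 * (m : ℝ)) +
        (m : ℝ) ^ ((1 : ℝ) / 4) * Real.sqrt (Real.log m) / (4 * (3 : ℝ) ^ ((1 : ℝ) / 4)) +
        3 * (m : ℝ) ^ ((1 : ℝ) / 4) / 2 := by
  obtain ⟨D, hD⟩ : ∃ D : ℕ, D = ⌈Real.sqrt (3 * (m : ℝ))⌉₊ := ⟨_, rfl⟩
  have hm1 : (1 : ℝ) ≤ m := by exact_mod_cast hm
  have h1 : Real.sqrt (3 * (m : ℝ)) ≤ D := by rw [hD]; exact Nat.le_ceil _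
  have h2 : (D : ℝ) < Real.sqrt (3 * (m : ℝ)) + 1 := by
    rw [hD]; exact Nat.ceil_lt_add_one (Real.sqrt_nonneg _)
  have h3 : 3 * (m : ℝ) ≤ (D : ℝ) ^ 2 := (Real.sqrt_le_left (by positivity)).1 h1
  have h3' : 3 * m ≤ D ^ 2 := by exact_mod_cast h3
  have hD2 : 2 ≤ D := by
    by_contra hcon
    have : D ≤ 1 := by omega
    have : D ^ 2 ≤ 1 := by nlinarith
    omega
  have h4 : (G.tww : ℝ) ≤ D := by exact_mod_cast tww_le_nat m D hm G hedges hD2 h3'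
  have h5 : (1 : ℝ) ≤ (m : ℝ) ^ ((1 : ℝ) / 4) := Real.one_le_rpow hm1 (by norm_num)
  have h6 : 0 ≤ (m : ℝ) ^ ((1 : ℝ) / 4) * Real.sqrt (Real.log m) / (4 * (3 : ℝ) ^ ((1 : ℝ) / 4)) := by
    positivity
  linarith
end

section
/- For each prime power q with q ≡ 1 (mod 4), the Paley graph P(q) has twin-width exactly (q−1)/2. -/
/-- The Paley graph on a finite field `F`: distinct `a` and `b` are adjacent iff
`a - b` is a nonzero square. (For `|F| ≡ 1 (mod 4)`, `−1` is a square, so the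
defining relation is already symmetric and the symmetrization is harmless.) -/
def paleyGraph (F : Type*) [Field F] : SimpleGraph F :=
  SimpleGraph.fromRel (fun a b => ∃ c : F, c ≠ 0 ∧ a - b = c ^ 2)

namespace PaleyTww

open Trigraph Finset

set_option linter.unusedSectionVars false

section triv
variable {V : Type*} [DecidableEq V]

def Good (d : ℕ) (G : Trigraph V) : Prop :=
  ∃ L : List (V × V), G.ValidSeq L ∧ (G.applySeq L).verts.card = 1 ∧
    ∀ L' : List (V × V), L' <+: L → ∀ v, (G.applySeq L').redDeg v ≤ d

lemma good_step {d : ℕ} {G : Trigraph V} (h : ∀ v, G.redDeg v ≤ d) {u v : V}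
    (hu : u ∈ G.verts) (hv : v ∈ G.verts) (huv : u ≠ v) (hg : Good d (G.contract u v)) :
    Good d G := by
  obtain ⟨L, h1, h2, h3⟩ := hg
  refine ⟨(u, v) :: L, ⟨hu, hv, huv, h1⟩, h2, ?_⟩
  intro L' hL'
  cases L' with
  | nil => exact h
  | cons p L' =>
    obtain ⟨rfl, hp⟩ := List.cons_prefix_cons.1 hL'
    exact h3 L' hp

lemma redDeg_le_card (G : Trigraph V) (v : V) : G.redDeg v ≤ G.verts.card - 1 := by
  unfold redDeg
  by_cases hv : v ∈ G.verts
  · rw [← Finset.card_erase_of_mem hv, ← Set.ncard_coe_finset]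
    apply Set.ncard_le_ncard
    · intro w hw
      have := G.red_mem _ _ (G.red_symm _ _ hw)
      have h2 := G.red_ne _ _ hw
      simp [this, h2.symm]
    · exact Finset.finite_toSet _
  · have : {w | G.Red v w} = ∅ := by
      ext w
      simp only [Set.mem_ofPred_eq, Set.mem_empty_iff_false, iff_false]
      exact fun h => hv (G.red_mem _ _ h)
    simp [this]

lemma good_small (d n : ℕ) : ∀ G : Trigraph V, G.verts.card = n + 1 → n ≤ d → Good d G := by
  induction n with
  | zero =>
    intro G hG _
    refine ⟨[], trivial, hG, ?_⟩
    intro L' hL' v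
    obtain rfl := List.prefix_nil.1 hL'
    have := redDeg_le_card G v
    show G.redDeg v ≤ d
    omega
  | succ n ih =>
    intro G hG hn
    obtain ⟨u, hu, v, hv, huv⟩ := Finset.one_lt_card.1 (show 1 < G.verts.card by omega)
    refine good_step (fun w => ?_) hu hv huv (ih _ ?_ (by omega))
    · have := redDeg_le_card G w
      omega
    · show (G.verts.erase v).card = _
      rw [Finset.card_erase_of_mem hv]; omega

end triv

section field
variable {F : Type*} [Field F] [Fintype F] [DecidableEq F]

lemma char_ne (hq : Fintype.card F % 4 = 1) : ringChar F ≠ 2 := by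
  intro h
  have := FiniteField.even_card_of_char_two h
  omega

lemma chi_neg (hq : Fintype.card F % 4 = 1) (x : F) :
    quadraticChar F (-x) = quadraticChar F x := by
  have h1 : IsSquare (-1 : F) := FiniteField.isSquare_neg_one_iff.2 (by omega)
  have h2 : quadraticChar F (-1) = 1 := (quadraticChar_one_iff_isSquare (by simp)).2 h1
  rw [← neg_one_mul, map_mul, h2, one_mul]

lemma adj_iff (hq : Fintype.card F % 4 = 1) (a b : F) :
    (paleyGraph F).Adj a b ↔ quadraticChar F (a - b) = 1 := by
  have key : ∀ a b : F, a ≠ b →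
      ((∃ c : F, c ≠ 0 ∧ a - b = c ^ 2) ↔ quadraticChar F (a - b) = 1) := by
    intro a b hab
    rw [quadraticChar_one_iff_isSquare (sub_ne_zero.2 hab), isSquare_iff_exists_sq]
    constructor
    · rintro ⟨c, _, h⟩; exact ⟨c, h⟩
    · rintro ⟨c, h⟩
      refine ⟨c, ?_, h⟩
      rintro rfl
      exact hab (sub_eq_zero.1 (by simpa using h))
  unfold paleyGraph
  rw [SimpleGraph.fromRel_adj]
  by_cases hab : a = b
  · subst hab; simp
  · rw [key a b hab, key b a (Ne.symm hab), ← neg_sub a b, chi_neg hq]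
    simp [hab]

lemma chi_sum (hq : Fintype.card F % 4 = 1) {u v : F} (huv : u ≠ v) :
    ∑ b : F, quadraticChar F (b - u) * quadraticChar F (b - v) = -1 := by
  have hc : v - u ≠ 0 := sub_ne_zero.2 huv.symm
  have hn : quadraticChar F ≠ 1 := quadraticChar_ne_one (char_ne hq)
  have h := jacobiSum_nontrivial_inv hn
  rw [(quadraticChar_isQuadratic F).inv] at h
  have h2 : quadraticChar F (-1) = 1 := by rw [chi_neg hq]; simp
  rw [h2] at h
  rw [← h, jacobiSum]
  symm
  refine Fintype.sum_equiv ((Equiv.mulLeft₀ (v - u) hc).trans (Equiv.addRight u)) _ _ ?_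
  intro x
  simp only [Equiv.trans_apply, Equiv.mulLeft₀_apply, Equiv.coe_addRight]
  have e1 : (v - u) * x + u - u = (v - u) * x := by ring
  have e2 : (v - u) * x + u - v = -((v - u) * (1 - x)) := by ring
  rw [e1, e2, chi_neg hq, map_mul, map_mul]
  have := quadraticChar_sq_one hc
  linear_combination (-(quadraticChar F x * quadraticChar F (1 - x))) * this

lemma card_sep (hq : Fintype.card F % 4 = 1) {u v : F} (huv : u ≠ v) :
    (univ.filter fun b : F => quadraticChar F (b - u) * quadraticChar F (b - v) = -1).card
      = (Fintype.card F - 1) / 2 := by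
  have h := chi_sum hq huv
  have e : ∀ b : F, 1 - quadraticChar F (b - u) * quadraticChar F (b - v) =
      2 * (if quadraticChar F (b - u) * quadraticChar F (b - v) = -1 then 1 else 0) +
      (if b = u then 1 else 0) + (if b = v then 1 else 0) := by
    intro b
    by_cases h1 : b = u
    · subst h1; simp [huv]
    by_cases h2 : b = v
    · subst h2; simp [h1]
    rcases quadraticChar_dichotomy (sub_ne_zero.2 h1) with h3 | h3 <;>
    rcases quadraticChar_dichotomy (sub_ne_zero.2 h2) with h4 | h4 <;>
    simp [h1, h2, h3, h4]
  have s := Finset.sum_congr (rfl : (univ : Finset F) = univ) (fun b _ => e b)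
  rw [Finset.sum_sub_distrib, h, Finset.sum_add_distrib, Finset.sum_add_distrib,
    ← Finset.mul_sum, Finset.sum_boole] at s
  simp only [Finset.sum_const, Finset.card_univ, Finset.sum_ite_eq', Finset.mem_univ, if_true,
    nsmul_eq_mul, mul_one] at s
  omega

lemma sep_iff (hq : Fintype.card F % 4 = 1) {u v b : F} (hu : b ≠ u) (hv : b ≠ v) :
    quadraticChar F (b - u) * quadraticChar F (b - v) = -1 ↔
      ¬ ((paleyGraph F).Adj u b ↔ (paleyGraph F).Adj v b) := by
  rw [(paleyGraph F).adj_comm u, (paleyGraph F).adj_comm v, adj_iff hq, adj_iff hq]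
  rcases quadraticChar_dichotomy (sub_ne_zero.2 hu) with h3 | h3 <;>
  rcases quadraticChar_dichotomy (sub_ne_zero.2 hv) with h4 | h4 <;>
  simp [h3, h4]

lemma lower (hq : Fintype.card F % 4 = 1) {d : ℕ} (h : Good d (paleyGraph F).toTrigraph) :
    (Fintype.card F - 1) / 2 ≤ d := by
  obtain ⟨L, h1, h2, h3⟩ := h
  cases L with
  | nil =>
    have : Fintype.card F = 1 := h2
    omega
  | cons p L =>
    obtain ⟨u, v⟩ := p
    obtain ⟨_, _, huv, _⟩ := h1
    refine le_trans ?_ (h3 [(u, v)] (by simp) u)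
    change u ≠ v at huv
    rw [← card_sep hq huv, ← Set.ncard_coe_finset]
    apply Set.ncard_le_ncard _ (Set.toFinite _)
    intro b hb
    simp only [coe_filter, mem_univ, true_and, Set.mem_ofPred_eq] at hb
    have hbu : b ≠ u := by rintro rfl; simp at hb
    have hbv : b ≠ v := by rintro rfl; simp at hb
    rw [sep_iff hq hbu hbv] at hb
    refine ⟨by simpa [SimpleGraph.toTrigraph] using huv,
      by simpa [SimpleGraph.toTrigraph] using hbv, hbu.symm, Or.inl ⟨rfl, ?_⟩⟩
    simp only [SimpleGraph.toTrigraph, Trigraph.Adj]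
    tauto

structure Inv (A : Finset F) (H : Trigraph F) : Prop where
  verts : ∀ a, a ∈ H.verts ↔ -a ∉ A
  dis : ∀ a ∈ A, -a ∉ A
  black : ∀ a b, H.Black a b ↔ -a ∉ A ∧ -b ∉ A ∧ a ≠ b ∧ (paleyGraph F).Adj a b ∧
    (a ∈ A ∨ b ∈ A → (paleyGraph F).Adj a (-b))
  red : ∀ a b, H.Red a b ↔ -a ∉ A ∧ -b ∉ A ∧ a ≠ b ∧ (a ∈ A ∨ b ∈ A) ∧
    ¬ ((paleyGraph F).Adj a b ↔ (paleyGraph F).Adj a (-b))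

lemma adj_neg (hq : Fintype.card F % 4 = 1) (a b : F) :
    (paleyGraph F).Adj (-a) b ↔ (paleyGraph F).Adj a (-b) := by
  rw [adj_iff hq, adj_iff hq, ← chi_neg hq (-a - b)]
  ring_nf

lemma inv_nil : Inv (∅ : Finset F) (paleyGraph F).toTrigraph := by
  constructor <;> simp [SimpleGraph.toTrigraph]
  intro a b h; exact h.ne

lemma ne_neg (hq : Fintype.card F % 4 = 1) {u : F} (hu : u ≠ 0) : u ≠ -u := by
  intro h
  exact hu ((Ring.eq_self_iff_eq_zero_of_char_ne_two (char_ne hq)).1 h.symm)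

lemma inv_card (hq : Fintype.card F % 4 = 1) {A : Finset F} {H : Trigraph F} (h : Inv A H) :
    A.card ≤ (Fintype.card F - 1) / 2 ∧ H.verts.card = Fintype.card F - A.card ∧
    (A ∪ A.image Neg.neg).card = 2 * A.card := by
  have hi : (A.image Neg.neg).card = A.card := Finset.card_image_of_injective _ neg_injective
  have hd : Disjoint A (A.image Neg.neg) := by
    rw [Finset.disjoint_left]
    intro a ha hb
    obtain ⟨b, hb', rfl⟩ := Finset.mem_image.1 hb
    exact h.dis b hb' ha
  have hu : (A ∪ A.image Neg.neg).card = 2 * A.card := by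
    rw [Finset.card_union_of_disjoint hd, hi]; omega
  have hle := Finset.card_le_univ (A ∪ A.image Neg.neg)
  refine ⟨by omega, ?_, hu⟩
  have : H.verts = (A.image Neg.neg)ᶜ := by
    ext a
    rw [h.verts, Finset.mem_compl, Finset.mem_image, not_iff_not]
    exact ⟨fun h => ⟨_, h, neg_neg a⟩, by rintro ⟨b, hb, rfl⟩; simpa using hb⟩
  rw [this, Finset.card_compl, hi]

lemma inv_redDeg (hq : Fintype.card F % 4 = 1) {A : Finset F} {H : Trigraph F} (h : Inv A H)
    (a : F) : H.redDeg a ≤ (Fintype.card F - 1) / 2 := by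
  unfold redDeg
  by_cases ha : a ∈ A
  · have hna := h.dis a ha
    have haa : a ≠ -a := fun e => hna (e ▸ ha)
    rw [← card_sep hq haa, ← Set.ncard_coe_finset]
    apply Set.ncard_le_ncard _ (Set.toFinite _)
    intro b hb
    obtain ⟨_, h2, h3, _, h5⟩ := (h.red a b).1 hb
    have h6 : b ≠ -a := by rintro rfl; simp [ha] at h2
    simp only [coe_filter, mem_univ, true_and, Set.mem_ofPred_eq]
    rw [sep_iff hq h3.symm h6, adj_neg hq]
    exact h5
  · refine le_trans ?_ (inv_card hq h).1
    rw [← Set.ncard_coe_finset]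
    apply Set.ncard_le_ncard _ (Set.toFinite _)
    intro b hb
    have := ((h.red a b).1 hb).2.2.2.1
    simpa [ha] using this

set_option maxHeartbeats 1000000 in
lemma inv_step (hq : Fintype.card F % 4 = 1) {A : Finset F} {H : Trigraph F} (h : Inv A H)
    {u : F} (hu0 : u ≠ 0) (hu : u ∉ A) (hu' : -u ∉ A) :
    Inv (insert u A) (H.contract u (-u)) := by
  have hne := ne_neg hq hu0
  have hn : ∀ a : F, -a = u ↔ a = -u := fun a => neg_eq_iff_eq_neg
  have hadj := adj_neg hq
  have hs := fun a b : F => (paleyGraph F).adj_comm a b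
  refine ⟨?_, ?_, ?_, ?_⟩
  · intro a
    show a ∈ H.verts.erase (-u) ↔ _
    simp only [Finset.mem_erase, h.verts, Finset.mem_insert, hn]
    tauto
  · intro a ha
    simp only [Finset.mem_insert, hn] at ha ⊢
    rcases ha with rfl | ha
    · tauto
    · rintro (rfl | h')
      · exact hu' ha
      · exact h.dis a ha h'
  · intro a b
    simp only [Trigraph.contract, Finset.mem_erase, h.verts, h.black, Finset.mem_insert, hn]
    by_cases ha : a = u
    · subst ha
      have e1 := hadj a b
      have e2 := hadj a (-b)
      have e3 : -b = a ↔ b = -a := neg_eq_iff_eq_neg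
      have e4 : -a = b ↔ b = -a := eq_comm
      have e5 : a = b ↔ b = a := eq_comm
      have e6 := h.dis b
      rw [neg_neg] at e2
      simp only [neg_neg]
      clear hadj hs hn h hq
      grind
    · by_cases hb : b = u
      · subst hb
        have e1 := hadj b a
        have e2 := hadj b (-a)
        have e0 := hs b a
        have e00 := hs (-b) a
        have e3 : -a = b ↔ a = -b := neg_eq_iff_eq_neg
        have e4 : -b = a ↔ a = -b := eq_comm
        have e5 : b = a ↔ a = b := eq_comm
        have e6 := h.dis a
        rw [neg_neg] at e2
        simp only [neg_neg]
        clear hadj hs hn h hq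
        grind
      · clear hadj hs hn h hq
        grind
  · intro a b
    simp only [Trigraph.contract, Trigraph.Adj, Finset.mem_erase, h.verts, h.black, h.red,
      Finset.mem_insert, hn]
    by_cases ha : a = u
    · subst ha
      have e1 := hadj a b
      have e2 := hadj a (-b)
      have e3 : -b = a ↔ b = -a := neg_eq_iff_eq_neg
      have e4 : -a = b ↔ b = -a := eq_comm
      have e5 : a = b ↔ b = a := eq_comm
      have e6 := h.dis b
      rw [neg_neg] at e2
      simp only [neg_neg]
      clear hadj hs hn h hq
      grind
    · by_cases hb : b = u
      · subst hb
        have e1 := hadj b a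
        have e2 := hadj b (-a)
        have e0 := hs b a
        have e00 := hs (-b) a
        have e3 : -a = b ↔ a = -b := neg_eq_iff_eq_neg
        have e4 : -b = a ↔ a = -b := eq_comm
        have e5 : b = a ↔ a = b := eq_comm
        have e6 := h.dis a
        rw [neg_neg] at e2
        simp only [neg_neg]
        clear hadj hs hn h hq
        grind
      · clear hadj hs hn h hq
        grind

lemma good_inv (hq : Fintype.card F % 4 = 1) (n : ℕ) : ∀ (A : Finset F) (H : Trigraph F),
    Inv A H → A.card + n = (Fintype.card F - 1) / 2 → Good ((Fintype.card F - 1) / 2) H := by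
  induction n with
  | zero =>
    intro A H h hn
    have := inv_card hq h
    exact good_small _ ((Fintype.card F - 1) / 2) H (by omega) le_rfl
  | succ n ih =>
    intro A H h hn
    obtain ⟨_, h2, h3⟩ := inv_card hq h
    have : ∃ u, u ∉ insert 0 (A ∪ A.image Neg.neg) := by
      by_contra! hc
      have := Finset.card_insert_le 0 (A ∪ A.image Neg.neg)
      rw [Finset.eq_univ_of_forall hc, Finset.card_univ] at this
      omega
    obtain ⟨u, hu⟩ := this
    simp only [Finset.mem_insert, Finset.mem_union, not_or] at hu
    obtain ⟨hu0, hu1, hu2⟩ := hu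
    have hu' : -u ∉ A := fun hh => hu2 (Finset.mem_image.2 ⟨_, hh, neg_neg u⟩)
    refine good_step (inv_redDeg hq h) (u := u) (v := -u) ((h.verts _).2 hu')
      ((h.verts _).2 (by simpa using hu1)) (ne_neg hq hu0)
      (ih _ _ (inv_step hq h hu0 hu1 hu') ?_)
    rw [Finset.card_insert_of_notMem hu1]; omega

end field

end PaleyTww

/-- **Theorem 4.** For each prime power `q ≡ 1 (mod 4)`, the Paley graph `P(q)` has
twin-width exactly `(q−1)/2`. (Every finite field has prime-power order, and every
such prime power arises, so quantifying over finite fields is equivalent.) -/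
theorem tww_paleyGraph (F : Type*) [Field F] [Fintype F] [DecidableEq F]
    (hq : Fintype.card F % 4 = 1) :
    (paleyGraph F).tww = (Fintype.card F - 1) / 2 := by
  have hg := PaleyTww.good_inv hq ((Fintype.card F - 1) / 2) ∅ _ PaleyTww.inv_nil (by simp)
  apply le_antisymm
  · exact Nat.sInf_le hg
  · exact le_csInf ⟨_, hg⟩ fun d hd => PaleyTww.lower hq hd
end

section
/- Let p : ℕ → [0,1] be a function with p(n)·n^{4/3} → 0 as n → ∞. Then asymptotically almost surely the random graph G(n, p(n)) has twin-width 0. -/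
/-- The probability, under the Erdős–Rényi random graph `G(n,p)` on vertex set
`Fin n`, of the event `A`: each graph `G` occurs with probability
`p^{e(G)} (1-p)^{C(n,2)-e(G)}`. -/
noncomputable def erProb (n : ℕ) (p : ℝ) (A : Set (SimpleGraph (Fin n))) : ℝ :=
  ∑ᶠ G ∈ A, p ^ G.edgeSet.ncard * (1 - p) ^ (n.choose 2 - G.edgeSet.ncard)

namespace Trigraph

/-- No path on four vertices as a black subgraph. -/
def NoP4 {V : Type*} (G : Trigraph V) : Prop :=
  ∀ a b c d, G.Black a b → G.Black b c → G.Black c d → a ≠ c → b ≠ d → a ≠ d → False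

lemma exists_twins {V : Type*} [DecidableEq V] (G : Trigraph V) (h : G.NoP4)
    (hc : 1 < G.verts.card) :
    ∃ u ∈ G.verts, ∃ v ∈ G.verts, u ≠ v ∧
      ∀ y, y ≠ u → y ≠ v → (G.Black u y ↔ G.Black v y) := by
  have key : ∀ u v w, G.Black u v → G.Black u w → v ≠ w →
      ∃ u ∈ G.verts, ∃ v ∈ G.verts, u ≠ v ∧
      ∀ y, y ≠ u → y ≠ v → (G.Black u y ↔ G.Black v y) := by
    intro u v w huv huw hvw
    refine ⟨v, G.black_mem _ _ (G.black_symm _ _ huv), w,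
      G.black_mem _ _ (G.black_symm _ _ huw), hvw, ?_⟩
    intro y hyv hyw
    constructor
    · intro hvy
      by_cases hyu : y = u
      · subst hyu; exact G.black_symm _ _ huw
      · exact (h y v u w (G.black_symm _ _ hvy) (G.black_symm _ _ huv) huw hyu hvw hyw).elim
    · intro hwy
      by_cases hyu : y = u
      · subst hyu; exact G.black_symm _ _ huv
      · exact (h y w u v (G.black_symm _ _ hwy) (G.black_symm _ _ huw) huv hyu hvw.symm hyv).elim
  by_cases he : ∃ u v, G.Black u v
  · obtain ⟨u, v, huv⟩ := he
    by_cases h1 : ∃ w, G.Black u w ∧ v ≠ w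
    · obtain ⟨w, hw, hvw⟩ := h1
      exact key u v w huv hw hvw
    by_cases h2 : ∃ w, G.Black v w ∧ u ≠ w
    · obtain ⟨w, hw, hvw⟩ := h2
      exact key v u w (G.black_symm _ _ huv) hw hvw
    refine ⟨u, G.black_mem _ _ huv, v, G.black_mem _ _ (G.black_symm _ _ huv),
      G.black_ne _ _ huv, ?_⟩
    intro y hyu hyv
    exact ⟨fun hh => (h1 ⟨y, hh, hyv.symm⟩).elim, fun hh => (h2 ⟨y, hh, hyu.symm⟩).elim⟩
  · obtain ⟨u, hu, v, hv, huv⟩ := Finset.one_lt_card.mp hc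
    exact ⟨u, hu, v, hv, huv, fun y _ _ => ⟨fun hh => (he ⟨_, _, hh⟩).elim,
      fun hh => (he ⟨_, _, hh⟩).elim⟩⟩

lemma exists_seq_s4 {V : Type*} [DecidableEq V] (k : ℕ) :
    ∀ G : Trigraph V, G.verts.card = k + 1 → G.NoP4 → (∀ x y, ¬ G.Red x y) →
    ∃ L : List (V × V), G.ValidSeq L ∧ (G.applySeq L).verts.card = 1 ∧
    ∀ L' : List (V × V), L' <+: L → ∀ v, (G.applySeq L').redDeg v ≤ 0 := by
  have red0 : ∀ G : Trigraph V, (∀ x y, ¬ G.Red x y) → ∀ v, G.redDeg v ≤ 0 := by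
    intro G hr v
    simp [redDeg, hr]
  induction k with
  | zero =>
    intro G hc h hr
    refine ⟨[], trivial, hc, ?_⟩
    intro L' hL' v
    rw [List.prefix_nil.mp hL']
    exact red0 G hr v
  | succ k ih =>
    intro G hc h hr
    obtain ⟨u, hu, v, hv, huv, ht⟩ := G.exists_twins h (by omega)
    have hcard : (G.contract u v).verts.card = k + 1 := by
      change (G.verts.erase v).card = k + 1
      rw [Finset.card_erase_of_mem hv, hc]; rfl
    have hB : ∀ x y, (G.contract u v).Black x y → G.Black x y := by
      rintro x y ⟨_, _, _, ⟨rfl, h1, _⟩ | ⟨rfl, h1, _⟩ | ⟨_, _, h1⟩⟩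
      · exact h1
      · exact G.black_symm _ _ h1
      · exact h1
    have hR : ∀ x y, ¬ (G.contract u v).Red x y := by
      rintro x y ⟨hx, hy, hxy, ⟨rfl, h1, h2⟩ | ⟨rfl, h1, h2⟩ | ⟨_, _, h1⟩⟩
      · have := ht y hxy.symm (Finset.ne_of_mem_erase hy)
        simp only [Adj, hr, or_false] at h1
        tauto
      · have := ht x hxy (Finset.ne_of_mem_erase hx)
        simp only [Adj, hr, or_false] at h1
        tauto
      · exact hr _ _ h1
    obtain ⟨L, hL1, hL2, hL3⟩ := ih (G.contract u v) hcard
      (fun a b c d h1 h2 h3 => h a b c d (hB _ _ h1) (hB _ _ h2) (hB _ _ h3)) hR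
    refine ⟨(u, v) :: L, ⟨hu, hv, huv, hL1⟩, hL2, ?_⟩
    intro L' hL' x
    cases L' with
    | nil => exact red0 G hr x
    | cons q L'' =>
      rw [List.cons_prefix_cons] at hL'
      obtain ⟨rfl, hL'⟩ := hL'
      exact hL3 L'' hL' x

end Trigraph

lemma tww_zero_of_noP4 {n : ℕ} (hn : 0 < n) (G : SimpleGraph (Fin n))
    (h : ∀ a b c d, G.Adj a b → G.Adj b c → G.Adj c d → a ≠ c → b ≠ d → a ≠ d → False) :
    G.tww = 0 := by
  obtain ⟨k, rfl⟩ : ∃ k, n = k + 1 := ⟨n - 1, by omega⟩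
  have := Trigraph.exists_seq_s4 k G.toTrigraph (by simp [SimpleGraph.toTrigraph]) h
    (fun _ _ hh => hh)
  unfold SimpleGraph.tww Trigraph.tww
  exact Nat.sInf_eq_zero.mpr (Or.inl this)

open Classical in
lemma er_sum (n : ℕ) (F : Finset (Sym2 (Fin n)) → ℝ) :
    ∑ G : SimpleGraph (Fin n), F G.edgeFinset
      = ∑ S ∈ (⊤ : SimpleGraph (Fin n)).edgeFinset.powerset, F S := by
  refine Finset.sum_bij' (fun G _ => G.edgeFinset)
    (fun S _ => SimpleGraph.fromEdgeSet (S : Set (Sym2 (Fin n)))) ?_ ?_ ?_ ?_ ?_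
  · intro G _
    rw [Finset.mem_powerset, SimpleGraph.edgeFinset_subset_edgeFinset]
    exact le_top
  · simp
  · intro G _
    simp
  · intro S hS
    rw [Finset.mem_powerset] at hS
    ext e
    simp only [SimpleGraph.mem_edgeFinset, SimpleGraph.edgeSet_fromEdgeSet, Set.mem_diff,
      Finset.mem_coe]
    constructor
    · exact fun h => h.1
    · intro h
      refine ⟨h, ?_⟩
      have := hS h
      rw [SimpleGraph.mem_edgeFinset] at this
      exact SimpleGraph.not_isDiag_of_mem_edgeSet _ this
  · intro G _; rfl

open Classical in
lemma er_contain (n : ℕ) (p : ℝ) (T : Finset (Sym2 (Fin n)))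
    (hT : T ⊆ (⊤ : SimpleGraph (Fin n)).edgeFinset) :
    ∑ G : SimpleGraph (Fin n), (if T ⊆ G.edgeFinset then
      p ^ G.edgeFinset.card * (1 - p) ^ (n.choose 2 - G.edgeFinset.card) else 0)
      = p ^ T.card := by
  rw [er_sum n (fun S => if T ⊆ S then p ^ S.card * (1 - p) ^ (n.choose 2 - S.card) else 0)]
  set E := (⊤ : SimpleGraph (Fin n)).edgeFinset with hE
  have hEc : E.card = n.choose 2 := by
    rw [hE, SimpleGraph.card_edgeFinset_top_eq_card_choose_two, Fintype.card_fin]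
  rw [← Finset.sum_filter]
  have : ∑ S ∈ E.powerset with T ⊆ S, p ^ S.card * (1 - p) ^ (n.choose 2 - S.card)
      = ∑ S ∈ (E \ T).powerset, p ^ T.card * (p ^ S.card * (1 - p) ^ ((E \ T).card - S.card)) := by
    refine Finset.sum_bij' (fun S _ => S \ T) (fun S _ => S ∪ T) ?_ ?_ ?_ ?_ ?_
    · intro S hS
      simp only [Finset.mem_filter, Finset.mem_powerset] at hS ⊢
      exact Finset.sdiff_subset_sdiff hS.1 le_rfl
    · intro S hS
      simp only [Finset.mem_filter, Finset.mem_powerset] at hS ⊢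
      exact ⟨Finset.union_subset (hS.trans Finset.sdiff_subset) hT, Finset.subset_union_right⟩
    · intro S hS
      simp only [Finset.mem_filter, Finset.mem_powerset] at hS
      exact Finset.sdiff_union_of_subset hS.2
    · intro S hS
      simp only [Finset.mem_powerset] at hS
      rw [Finset.union_sdiff_right]
      exact Finset.sdiff_eq_self_of_disjoint (Finset.disjoint_of_subset_left hS Finset.sdiff_disjoint)
    · intro S hS
      simp only [Finset.mem_filter, Finset.mem_powerset] at hS
      have h1 := Finset.card_sdiff_add_card_eq_card hS.2
      have h2 := Finset.card_sdiff_add_card_eq_card hT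
      have h3 := Finset.card_le_card hS.1
      rw [← mul_assoc, ← pow_add]
      congr 2 <;> omega
  rw [this, ← Finset.mul_sum, Finset.sum_pow_mul_eq_add_pow]
  simp

open Classical in
lemma er_bound (n : ℕ) (hn : 0 < n) (p : ℝ) (hp : p ∈ Set.Icc (0 : ℝ) 1) :
    1 - (n : ℝ) ^ 4 * p ^ 3 ≤ erProb n p {G : SimpleGraph (Fin n) | G.tww = 0} ∧
    erProb n p {G : SimpleGraph (Fin n) | G.tww = 0} ≤ 1 := by
  obtain ⟨hp0, hp1⟩ := hp
  set w : SimpleGraph (Fin n) → ℝ := fun G =>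
    p ^ G.edgeFinset.card * (1 - p) ^ (n.choose 2 - G.edgeFinset.card) with hw
  have hw0 : ∀ G, 0 ≤ w G := fun G =>
    mul_nonneg (pow_nonneg hp0 _) (pow_nonneg (by linarith) _)
  have hE : erProb n p {G : SimpleGraph (Fin n) | G.tww = 0}
      = ∑ G : SimpleGraph (Fin n), if G.tww = 0 then w G else 0 := by
    unfold erProb
    rw [← Finset.sum_filter, finsum_mem_eq_finite_toFinset_sum _ (Set.toFinite _)]
    refine Finset.sum_congr (by ext; simp) ?_
    intro G _
    have : G.edgeSet.ncard = G.edgeFinset.card := by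
      rw [Set.ncard_eq_toFinset_card']; rfl
    rw [hw, this]
  have h1 : ∑ G, w G = 1 := by
    have := er_contain n p ∅ (by simp)
    simpa using this
  rw [hE]
  constructor
  swap
  · rw [← h1]
    refine Finset.sum_le_sum fun G _ => ?_
    split_ifs
    · exact le_rfl
    · exact hw0 G
  let T : Fin n × Fin n × Fin n × Fin n → Finset (Sym2 (Fin n)) :=
    fun q => {s(q.1, q.2.1), s(q.2.1, q.2.2.1), s(q.2.2.1, q.2.2.2)}
  let Q : Finset (Fin n × Fin n × Fin n × Fin n) := Finset.univ.filter fun q =>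
    q.1 ≠ q.2.1 ∧ q.2.1 ≠ q.2.2.1 ∧ q.2.2.1 ≠ q.2.2.2 ∧ q.1 ≠ q.2.2.1 ∧ q.2.1 ≠ q.2.2.2
      ∧ q.1 ≠ q.2.2.2
  have hle : ∀ G : SimpleGraph (Fin n), w G ≤ (if G.tww = 0 then w G else 0) +
      ∑ q ∈ Q, if T q ⊆ G.edgeFinset then w G else 0 := by
    intro G
    have hnn : ∀ q ∈ Q, 0 ≤ (if T q ⊆ G.edgeFinset then w G else 0) := by
      intro q _
      split_ifs
      · exact hw0 G
      · exact le_rfl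
    split_ifs with ht
    · linarith [Finset.sum_nonneg hnn]
    · have : ∃ q ∈ Q, T q ⊆ G.edgeFinset := by
        by_contra hcon
        apply ht
        apply tww_zero_of_noP4 hn
        intro a b c d hab hbc hcd hac hbd had
        apply hcon
        refine ⟨(a, b, c, d), ?_, ?_⟩
        · simp only [Q, Finset.mem_filter, Finset.mem_univ, true_and]
          exact ⟨hab.ne, hbc.ne, hcd.ne, hac, hbd, had⟩
        · simp only [T, Finset.insert_subset_iff, Finset.singleton_subset_iff,
            SimpleGraph.mem_edgeFinset, SimpleGraph.mem_edgeSet]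
          exact ⟨hab, hbc, hcd⟩
      obtain ⟨q, hq, hTq⟩ := this
      have := Finset.single_le_sum hnn hq
      rw [if_pos hTq] at this
      linarith
  have hsum := Finset.sum_le_sum fun G (_ : G ∈ (Finset.univ : Finset (SimpleGraph (Fin n)))) => hle G
  rw [h1, Finset.sum_add_distrib, Finset.sum_comm (t := Q)] at hsum
  have hQ : ∑ q ∈ Q, ∑ G : SimpleGraph (Fin n), (if T q ⊆ G.edgeFinset then w G else 0)
      = ∑ q ∈ Q, p ^ 3 := by
    refine Finset.sum_congr rfl fun q hq => ?_
    obtain ⟨a, b, c, d⟩ := q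
    simp only [Q, Finset.mem_filter, Finset.mem_univ, true_and] at hq
    obtain ⟨hab, hbc, hcd, hac, hbd, had⟩ := hq
    have h3 : (T (a, b, c, d)).card = 3 := by
      apply Finset.card_eq_three.mpr
      refine ⟨_, _, _, ?_, ?_, ?_, rfl⟩ <;> simp [Sym2.eq_iff] <;> grind
    rw [← h3]
    apply er_contain
    simp [T, Finset.insert_subset_iff, hab, hbc, hcd]
  have hQc : (Q.card : ℝ) ≤ (n : ℝ) ^ 4 := by
    have : Q.card ≤ n ^ 4 := by
      refine (Finset.card_le_univ Q).trans (le_of_eq ?_)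
      simp only [Fintype.card_prod, Fintype.card_fin]; ring
    exact_mod_cast this
  rw [hQ, Finset.sum_const, nsmul_eq_mul] at hsum
  have := mul_le_mul_of_nonneg_right hQc (pow_nonneg hp0 3)
  linarith

/-- **Theorem 5(1).** If `p(n)·n^{4/3} → 0`, then a.a.s. `tww(G(n,p)) = 0`. -/
theorem tww_random_eq_zero (p : ℕ → ℝ) (hp01 : ∀ n, p n ∈ Set.Icc (0 : ℝ) 1)
    (hp : Filter.Tendsto (fun n : ℕ => p n * (n : ℝ) ^ ((4 : ℝ) / 3))
      Filter.atTop (nhds 0)) :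
    Filter.Tendsto
      (fun n : ℕ => erProb n (p n) {G : SimpleGraph (Fin n) | G.tww = 0})
      Filter.atTop (nhds 1) := by
  have h3 : Filter.Tendsto (fun n : ℕ => 1 - (p n * (n : ℝ) ^ ((4 : ℝ) / 3)) ^ 3)
      Filter.atTop (nhds 1) := by
    simpa using (hp.pow 3).const_sub 1
  refine tendsto_of_tendsto_of_tendsto_of_le_of_le' h3 tendsto_const_nhds ?_ ?_
  · filter_upwards [Filter.eventually_gt_atTop 0] with n hn
    have he : (p n * (n : ℝ) ^ ((4 : ℝ) / 3)) ^ 3 = (n : ℝ) ^ 4 * p n ^ 3 := by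
      rw [mul_pow, ← Real.rpow_natCast ((n : ℝ) ^ ((4 : ℝ) / 3)) 3,
        ← Real.rpow_mul (Nat.cast_nonneg n), mul_comm]
      norm_num
    rw [he]
    exact (er_bound n hn (p n) (hp01 n)).1
  · filter_upwards [Filter.eventually_gt_atTop 0] with n hn
    exact (er_bound n hn (p n) (hp01 n)).2
end

section
/- Let p : ℕ → [0,1] be a function with p(n)·n^{4/3} → ∞ and p(n)·n^{7/6} → 0 as n → ∞. Then asymptotically almost surely the random graph G(n, p(n)) has twin-width exactly 1. -/
/-- `G` contains an injective copy of the pattern with edges `E`. -/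
def HasCopy {V : Type*} {k : ℕ} (E : Finset (Fin k × Fin k)) (G : SimpleGraph V) : Prop :=
  ∃ f : Fin k → V, Function.Injective f ∧ ∀ e ∈ E, G.Adj (f e.1) (f e.2)

def patC3 : Finset (Fin 3 × Fin 3) := {(0,1),(1,2),(0,2)}
def patC4 : Finset (Fin 4 × Fin 4) := {(0,1),(1,2),(2,3),(0,3)}
def patC5 : Finset (Fin 5 × Fin 5) := {(0,1),(1,2),(2,3),(3,4),(0,4)}
def patC6 : Finset (Fin 6 × Fin 6) := {(0,1),(1,2),(2,3),(3,4),(4,5),(0,5)}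
def patP7 : Finset (Fin 7 × Fin 7) := {(0,1),(1,2),(2,3),(3,4),(4,5),(5,6)}
def patS7 : Finset (Fin 7 × Fin 7) := {(0,1),(0,2),(0,3),(1,4),(2,5),(3,6)}

structure NoBad {V : Type*} (G : SimpleGraph V) : Prop where
  c3 : ¬ HasCopy patC3 G
  c4 : ¬ HasCopy patC4 G
  c5 : ¬ HasCopy patC5 G
  c6 : ¬ HasCopy patC6 G
  p7 : ¬ HasCopy patP7 G
  s7 : ¬ HasCopy patS7 G

section det
variable {V : Type*} {G : SimpleGraph V}

lemma NoBad.h3 (h : NoBad G) {a b c : V} (h1 : G.Adj a b) (h2 : G.Adj b c) (h3 : G.Adj a c) :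
    False := by
  apply h.c3
  refine ⟨![a,b,c], ?_, ?_⟩
  · rw [← List.nodup_ofFn]
    simp [h1.ne, h2.ne, h3.ne]
  · simp [patC3, h1, h2, h3]

lemma NoBad.h4 (h : NoBad G) {a b c d : V} (h1 : G.Adj a b) (h2 : G.Adj b c) (h3 : G.Adj c d)
    (h4 : G.Adj a d) (n1 : a ≠ c) (n2 : b ≠ d) : False := by
  apply h.c4
  refine ⟨![a,b,c,d], ?_, ?_⟩
  · rw [← List.nodup_ofFn]
    simp [h1.ne, h2.ne, h3.ne, h4.ne, n1, n2]
  · simp [patC4, h1, h2, h3, h4]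

lemma NoBad.h5 (h : NoBad G) {a b c d e : V} (h1 : G.Adj a b) (h2 : G.Adj b c) (h3 : G.Adj c d)
    (h4 : G.Adj d e) (h5 : G.Adj a e) (n1 : a ≠ c) (n2 : b ≠ d) (n3 : c ≠ e)
    (n4 : a ≠ d) (n5 : b ≠ e) : False := by
  apply h.c5
  refine ⟨![a,b,c,d,e], ?_, ?_⟩
  · rw [← List.nodup_ofFn]
    simp [h1.ne, h2.ne, h3.ne, h4.ne, h5.ne, n1, n2, n3, n4, n5]
  · simp [patC5, h1, h2, h3, h4, h5]

lemma NoBad.h6 (h : NoBad G) {a b c d e f : V} (h1 : G.Adj a b) (h2 : G.Adj b c) (h3 : G.Adj c d)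
    (h4 : G.Adj d e) (h5 : G.Adj e f) (h6 : G.Adj a f) (n1 : a ≠ c) (n2 : b ≠ d) (n3 : c ≠ e)
    (n4 : a ≠ d) (n5 : b ≠ e) (n6 : d ≠ f) (n7 : c ≠ f) (n8 : b ≠ f) (n9 : a ≠ e) : False := by
  apply h.c6
  refine ⟨![a,b,c,d,e,f], ?_, ?_⟩
  · rw [← List.nodup_ofFn]
    simp [h1.ne, h2.ne, h3.ne, h4.ne, h5.ne, h6.ne, n1, n2, n3, n4, n5, n6, n7, n8, n9]
  · simp [patC6, h1, h2, h3, h4, h5, h6]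

lemma NoBad.walk (h : NoBad G) {a b c d e f g : V} (h1 : G.Adj a b) (h2 : G.Adj b c)
    (h3 : G.Adj c d) (h4 : G.Adj d e) (h5 : G.Adj e f) (h6 : G.Adj f g)
    (n1 : c ≠ a) (n2 : d ≠ b) (n3 : e ≠ c) (n4 : f ≠ d) (n5 : g ≠ e) : False := by
  have k3 : ∀ {a b c d : V}, G.Adj a b → G.Adj b c → G.Adj c d → a ≠ d := by
    rintro a b c d h1 h2 h3 rfl
    exact h.h3 h1 h2 h3.symm
  have k4 : ∀ {a b c d e : V}, G.Adj a b → G.Adj b c → G.Adj c d → G.Adj d e → c ≠ a → d ≠ b →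
      a ≠ e := by
    rintro a b c d e h1 h2 h3 h4 n1 n2 rfl
    exact h.h4 h1 h2 h3 h4.symm n1.symm n2.symm
  have k5 : ∀ {a b c d e f : V}, G.Adj a b → G.Adj b c → G.Adj c d → G.Adj d e → G.Adj e f →
      c ≠ a → d ≠ b → e ≠ c → a ≠ f := by
    rintro a b c d e f h1 h2 h3 h4 h5 n1 n2 n3 rfl
    exact h.h5 h1 h2 h3 h4 h5.symm n1.symm n2.symm n3.symm (k3 h1 h2 h3) (k3 h2 h3 h4)
  have m1 := k3 h1 h2 h3
  have m2 := k3 h2 h3 h4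
  have m3 := k3 h3 h4 h5
  have m4 := k3 h4 h5 h6
  have m5 := k4 h1 h2 h3 h4 n1 n2
  have m6 := k4 h2 h3 h4 h5 n2 n3
  have m7 := k4 h3 h4 h5 h6 n3 n4
  have m8 := k5 h1 h2 h3 h4 h5 n1 n2 n3
  have m9 := k5 h2 h3 h4 h5 h6 n2 n3 n4
  have m10 : a ≠ g := by
    rintro rfl
    exact h.h6 h1 h2 h3 h4 h5 h6.symm n1.symm n2.symm n3.symm m1 m2 n4.symm m3 m6 m5
  apply h.p7
  refine ⟨![a,b,c,d,e,f,g], ?_, ?_⟩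
  · rw [← List.nodup_ofFn]
    simp [h1.ne, h2.ne, h3.ne, h4.ne, h5.ne, h6.ne, n1.symm, n2.symm, n3.symm, n4.symm, n5.symm,
      m1, m2, m3, m4, m5, m6, m7, m8, m9, m10]
  · simp [patP7, h1, h2, h3, h4, h5, h6]

lemma NoBad.spider (h : NoBad G) {v a b c a' b' c' : V} (h1 : G.Adj v a) (h2 : G.Adj v b)
    (h3 : G.Adj v c) (h4 : G.Adj a a') (h5 : G.Adj b b') (h6 : G.Adj c c')
    (n1 : a ≠ b) (n2 : a ≠ c) (n3 : b ≠ c) (m1 : a' ≠ v) (m2 : b' ≠ v) (m3 : c' ≠ v) : False := by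
  have k3 : ∀ {a b a' : V}, G.Adj v a → G.Adj v b → G.Adj a a' → b ≠ a' := by
    rintro a b a' h1 h2 h3 rfl
    exact h.h3 h1 h3 h2
  have k4 : ∀ {a b a' b' : V}, G.Adj v a → G.Adj v b → G.Adj a a' → G.Adj b b' → a ≠ b → a' ≠ v →
      a' ≠ b' := by
    rintro a b a' b' h1 h2 h3 h4 n1 n2 rfl
    exact h.h4 h1 h3 h4.symm h2 n2.symm n1
  apply h.s7
  refine ⟨![v,a,b,c,a',b',c'], ?_, ?_⟩
  · rw [← List.nodup_ofFn]
    simp [h1.ne, h2.ne, h3.ne, h4.ne, h5.ne, h6.ne, n1, n2, n3, m1.symm, m2.symm, m3.symm,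
      k3 h1 h2 h4, k3 h1 h3 h4, k3 h2 h1 h5, k3 h2 h3 h5, k3 h3 h1 h6, k3 h3 h2 h6,
      k4 h1 h2 h4 h5 n1 m1, k4 h1 h3 h4 h6 n2 m1, k4 h2 h3 h5 h6 n3 m2]
  · simp [patS7, h1, h2, h3, h4, h5, h6]

lemma NoBad.degen (h : NoBad G) (S : Finset V) (hS : S.Nonempty) :
    ∃ y ∈ S, ∀ a ∈ S, ∀ b ∈ S, G.Adj y a → G.Adj y b → a = b := by
  by_contra hcon
  push Not at hcon
  have step : ∀ y ∈ S, ∀ x, ∃ z ∈ S, G.Adj y z ∧ z ≠ x := by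
    intro y hy x
    obtain ⟨a, ha, b, hb, hya, hyb, hab⟩ := hcon y hy
    by_cases hx : a = x
    · exact ⟨b, hb, hyb, fun hh => hab (hx.trans hh.symm)⟩
    · exact ⟨a, ha, hya, hx⟩
  obtain ⟨a, ha⟩ := hS
  obtain ⟨b, hb, h1, -⟩ := step a ha a
  obtain ⟨c, hc, h2, n1⟩ := step b hb a
  obtain ⟨d, hd, h3, n2⟩ := step c hc b
  obtain ⟨e, he, h4, n3⟩ := step d hd c
  obtain ⟨f, hf, h5, n4⟩ := step e he d
  obtain ⟨g, hg, h6, n5⟩ := step f hf e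
  exact h.walk h1 h2 h3 h4 h5 h6 n1 n2 n3 n4 n5

/-- `x` is a leaf of `G[S]` with neighbour `y`, and `y` has at most one non-leaf neighbour. -/
structure GoodPair (G : SimpleGraph V) (S : Finset V) (x y : V) : Prop where
  hx : x ∈ S
  hy : y ∈ S
  adj : G.Adj x y
  leaf : ∀ w ∈ S, G.Adj x w → w = y
  uniq : ∀ a ∈ S, ∀ b ∈ S, G.Adj y a → G.Adj y b → (∃ w ∈ S, w ≠ y ∧ G.Adj a w) →
    (∃ w ∈ S, w ≠ y ∧ G.Adj b w) → a = b

lemma NoBad.exists_good (h : NoBad G) (S : Finset V) {u w : V} (hu : u ∈ S) (hw : w ∈ S)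
    (huw : G.Adj u w) : ∃ x y, GoodPair G S x y := by
  classical
  let N := S.filter (fun y => ∃ a ∈ S, ∃ b ∈ S, G.Adj y a ∧ G.Adj y b ∧ a ≠ b)
  by_cases hN : N.Nonempty
  · obtain ⟨y, hyN, hy⟩ := h.degen N hN
    have hyS : y ∈ S := (Finset.mem_filter.1 hyN).1
    obtain ⟨a, ha, b, hb, hya, hyb, hab⟩ := (Finset.mem_filter.1 hyN).2
    have key : ∀ a ∈ S, G.Adj y a → (∃ w ∈ S, w ≠ y ∧ G.Adj a w) → a ∈ N := by
      rintro a ha hya ⟨w, hw, hwy, haw⟩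
      exact Finset.mem_filter.2 ⟨ha, w, hw, y, hyS, haw, hya.symm, hwy⟩
    have huniq : ∀ a ∈ S, ∀ b ∈ S, G.Adj y a → G.Adj y b → (∃ w ∈ S, w ≠ y ∧ G.Adj a w) →
      (∃ w ∈ S, w ≠ y ∧ G.Adj b w) → a = b := fun a ha b hb hya hyb h1 h2 =>
        hy a (key a ha hya h1) b (key b hb hyb h2) hya hyb
    by_cases hal : ∃ w ∈ S, w ≠ y ∧ G.Adj a w
    · refine ⟨b, y, hb, hyS, hyb.symm, ?_, huniq⟩
      intro w hw hbw
      by_contra hwy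
      exact hab (huniq a ha b hb hya hyb hal ⟨w, hw, hwy, hbw⟩)
    · refine ⟨a, y, ha, hyS, hya.symm, ?_, huniq⟩
      intro w hw haw
      by_contra hwy
      exact hal ⟨w, hw, hwy, haw⟩
  · have hno : ∀ y ∈ S, ∀ a ∈ S, ∀ b ∈ S, G.Adj y a → G.Adj y b → a = b := by
      intro y hy a ha b hb hya hyb
      by_contra hab
      exact hN ⟨y, Finset.mem_filter.2 ⟨hy, a, ha, b, hb, hya, hyb, hab⟩⟩
    exact ⟨u, w, hu, hw, huw, fun w' hw' hh => hno u hu _ hw' _ hw hh huw,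
      fun a ha b hb hya hyb _ _ => hno w hw a ha b hb hya hyb⟩

/-- After removing a leaf `x` attached to `y`. -/
lemma GoodPair.next [DecidableEq V] (h : NoBad G) {S : Finset V} {x y v : V}
    (hg : GoodPair G S x y)
    (hno : ∀ z ∈ S, z ≠ x → G.Adj y z → ∃ w ∈ S, w ≠ y ∧ G.Adj z w)
    (hv : v ∈ S) (hvx : v ≠ x) (hyv : G.Adj y v) : GoodPair G (S.erase x) y v := by
  refine ⟨?_, ?_, hyv, ?_, ?_⟩
  · exact Finset.mem_erase.2 ⟨hg.adj.ne.symm, hg.hy⟩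
  · exact Finset.mem_erase.2 ⟨hvx, hv⟩
  · intro w hw hyw
    obtain ⟨hwx, hw⟩ := Finset.mem_erase.1 hw
    exact hg.uniq w hw v hv hyw hyv (hno w hw hwx hyw) (hno v hv hvx hyv)
  · rintro a ha b hb hva hvb ⟨w, hw, hwv, haw⟩ ⟨w', hw', hwv', hbw'⟩
    by_contra hab
    have hy1 : ∀ a, a ∈ S.erase x → G.Adj v a → ∀ w ∈ S.erase x, w ≠ v → G.Adj a w → a ≠ y := by
      rintro a ha hva w hw hwv haw rfl
      obtain ⟨hwx, hw⟩ := Finset.mem_erase.1 hw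
      exact hwv (hg.uniq w hw v hv haw hyv (hno w hw hwx haw) (hno v hv hvx hyv))
    have h1 := hy1 a ha hva w hw hwv haw
    have h2 := hy1 b hb hvb w' hw' hwv' hbw'
    exact h.spider hyv.symm hva hvb hg.adj.symm haw hbw' h1.symm h2.symm hab hvx.symm hwv hwv'

open Trigraph

structure TInv (G : SimpleGraph V) (H : Trigraph V) : Prop where
  adj : ∀ u w, H.Adj u w ↔ u ∈ H.verts ∧ w ∈ H.verts ∧ G.Adj u w
  red : (∀ u w, ¬ H.Red u w) ∨ ∃ x y, GoodPair G H.verts x y ∧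
    ∀ u w, H.Red u w → (u = x ∧ w = y) ∨ (u = y ∧ w = x)

lemma TInv.redDeg {H : Trigraph V} (hI : TInv G H) (v : V) : H.redDeg v ≤ 1 := by
  unfold Trigraph.redDeg
  have hs : {w | H.Red v w}.Subsingleton := by
    intro a ha b hb
    simp only [Set.mem_ofPred_eq] at ha hb
    rcases hI.red with hr | ⟨x, y, hg, hr⟩
    · exact (hr _ _ ha).elim
    · have := hg.adj.ne
      rcases hr _ _ ha with ⟨h1, h2⟩ | ⟨h1, h2⟩ <;> rcases hr _ _ hb with ⟨h3, h4⟩ | ⟨h3, h4⟩ <;>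
        grind
  exact (Set.ncard_le_one hs.finite).2 hs

lemma TInv.adj_contract [DecidableEq V] {H : Trigraph V} (hI : TInv G H) {u v : V} (huv : u ≠ v)
    (hu : u ∈ H.verts) 
    (hsub : ∀ w ∈ H.verts, w ≠ u → G.Adj v w → G.Adj u w) :
    ∀ a b, (H.contract u v).Adj a b ↔ a ∈ (H.contract u v).verts ∧ b ∈ (H.contract u v).verts
      ∧ G.Adj a b := by
  intro a b
  have hA := hI.adj
  have hbs := H.black_symm
  have hrs := H.red_symm
  have hne : ∀ a b, G.Adj a b → a ≠ b := fun _ _ h => h.ne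
  have hs : ∀ a b, G.Adj a b → G.Adj b a := fun _ _ h => h.symm
  have hbn := H.black_ne
  simp only [Trigraph.Adj, Trigraph.contract, Finset.mem_erase] at *
  constructor
  · rintro (⟨⟨h1, h2⟩, ⟨h3, h4⟩, h5, h6⟩ | ⟨⟨h1, h2⟩, ⟨h3, h4⟩, h5, h6⟩)
    · refine ⟨⟨h1, h2⟩, ⟨h3, h4⟩, ?_⟩
      grind
    · refine ⟨⟨h1, h2⟩, ⟨h3, h4⟩, ?_⟩
      grind
  · rintro ⟨⟨h1, h2⟩, ⟨h3, h4⟩, h5⟩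
    have := hne _ _ h5
    have h6 := (hA a b).2 ⟨h2, h4, h5⟩
    by_cases hau : a = u
    · subst hau
      by_cases hb : H.Black a b ∧ H.Black v b
      · exact Or.inl ⟨⟨h1, h2⟩, ⟨h3, h4⟩, this, Or.inl ⟨rfl, hb⟩⟩
      · exact Or.inr ⟨⟨h1, h2⟩, ⟨h3, h4⟩, this, Or.inl ⟨rfl, Or.inl h6, hb⟩⟩
    · by_cases hbu : b = u
      · subst hbu
        have h6' := (hA b a).2 ⟨h4, h2, h5.symm⟩
        by_cases hb : H.Black b a ∧ H.Black v a
        · exact Or.inl ⟨⟨h1, h2⟩, ⟨h3, h4⟩, this, Or.inr (Or.inl ⟨rfl, hb⟩)⟩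
        · exact Or.inr ⟨⟨h1, h2⟩, ⟨h3, h4⟩, this, Or.inr (Or.inl ⟨rfl, Or.inl h6', hb⟩)⟩
      · rcases h6 with h6 | h6
        · exact Or.inl ⟨⟨h1, h2⟩, ⟨h3, h4⟩, this, Or.inr (Or.inr ⟨hau, hbu, h6⟩)⟩
        · exact Or.inr ⟨⟨h1, h2⟩, ⟨h3, h4⟩, this, Or.inr (Or.inr ⟨hau, hbu, h6⟩)⟩

lemma TInv.step [DecidableEq V] (h : NoBad G) {H : Trigraph V} (hI : TInv G H)
    (hc : 1 < H.verts.card) :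
    ∃ u ∈ H.verts, ∃ v ∈ H.verts, u ≠ v ∧ TInv G (H.contract u v) := by
  by_cases hE : ∃ u ∈ H.verts, ∃ w ∈ H.verts, G.Adj u w
  · obtain ⟨u, hu, w, hw, huw⟩ := hE
    have hex : ∃ x y, GoodPair G H.verts x y ∧
        ∀ u w, H.Red u w → (u = x ∧ w = y) ∨ (u = y ∧ w = x) := by
      rcases hI.red with hr | hr
      · obtain ⟨x, y, hxy⟩ := h.exists_good H.verts hu hw huw
        exact ⟨x, y, hxy, fun u w hh => (hr _ _ hh).elim⟩
      · exact hr
    obtain ⟨x, y, hg, hr⟩ := hex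
    by_cases hz : ∃ z ∈ H.verts, z ≠ x ∧ G.Adj y z ∧ ∀ w ∈ H.verts, G.Adj z w → w = y
    · obtain ⟨z, hzS, hzx, hyz, hzl⟩ := hz
      refine ⟨x, hg.hx, z, hzS, hzx.symm, hI.adj_contract hzx.symm hg.hx ?_, Or.inr ⟨x, y, ?_, ?_⟩⟩
      · intro w hw hwx hzw
        rw [hzl w hw hzw]; exact hg.adj
      · refine ⟨Finset.mem_erase.2 ⟨hzx.symm, hg.hx⟩, Finset.mem_erase.2 ⟨hyz.ne, hg.hy⟩, hg.adj,
          fun w hw => hg.leaf w (Finset.mem_of_mem_erase hw), ?_⟩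
        rintro a ha b hb hya hyb ⟨w, hw, hw'⟩ ⟨w2, hw2, hw2'⟩
        exact hg.uniq a (Finset.mem_of_mem_erase ha) b (Finset.mem_of_mem_erase hb) hya hyb
          ⟨w, Finset.mem_of_mem_erase hw, hw'⟩ ⟨w2, Finset.mem_of_mem_erase hw2, hw2'⟩
      · have key : ∀ w ∈ H.verts, H.Adj x w ∨ H.Adj z w → w = y := by
          rintro w hw (h1 | h1)
          · exact hg.leaf w hw ((hI.adj _ _).1 h1).2.2
          · exact hzl w hw ((hI.adj _ _).1 h1).2.2
        rintro u w ⟨h1, h2, h3, h4⟩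
        rcases h4 with ⟨h5, h6, h7⟩ | ⟨h5, h6, h7⟩ | ⟨h5, h6, h7⟩
        · exact Or.inl ⟨h5, key w (Finset.mem_of_mem_erase h2) h6⟩
        · exact Or.inr ⟨key u (Finset.mem_of_mem_erase h1) h6, h5⟩
        · exact hr u w h7
    · push Not at hz
      have hno : ∀ z ∈ H.verts, z ≠ x → G.Adj y z → ∃ w ∈ H.verts, w ≠ y ∧ G.Adj z w := by
        intro z h1 h2 h3
        obtain ⟨w, h4, h5, h6⟩ := hz z h1 h2 h3
        exact ⟨w, h4, h6, h5⟩
      have hadj := hI.adj_contract hg.adj.ne.symm hg.hy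
          (fun w hw hwy hxw => absurd (hg.leaf w hw hxw) hwy)
      refine ⟨y, hg.hy, x, hg.hx, hg.adj.ne.symm, hadj, ?_⟩
      have key : ∀ u w, (H.contract y x).Red u w →
          (u = y ∧ w ∈ H.verts ∧ w ≠ x ∧ G.Adj y w) ∨ (w = y ∧ u ∈ H.verts ∧ u ≠ x ∧ G.Adj y u) := by
        intro u w hR
        have h0 := ((hadj u w).1 (Or.inr hR)).2.2
        obtain ⟨h1, h2, h3, h4⟩ := hR
        obtain ⟨h1', h1⟩ := Finset.mem_erase.1 h1
        obtain ⟨h2', h2⟩ := Finset.mem_erase.1 h2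
        rcases h4 with ⟨rfl, h6, h7⟩ | ⟨rfl, h6, h7⟩ | ⟨h5, h6, h7⟩
        · exact Or.inl ⟨rfl, h2, h2', h0⟩
        · exact Or.inr ⟨rfl, h1, h1', h0.symm⟩
        · rcases hr u w h7 with ⟨h8, h9⟩ | ⟨h8, h9⟩
          · exact absurd h9 h6
          · exact absurd h8 h5
      by_cases hv : ∃ v ∈ H.verts, v ≠ x ∧ G.Adj y v
      · obtain ⟨v, hv, hvx, hyv⟩ := hv
        refine Or.inr ⟨y, v, hg.next h hno hv hvx hyv, ?_⟩
        intro u w hR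
        rcases key u w hR with ⟨h1, h2, h3, h4⟩ | ⟨h1, h2, h3, h4⟩
        · exact Or.inl ⟨h1, hg.uniq w h2 v hv h4 hyv (hno w h2 h3 h4) (hno v hv hvx hyv)⟩
        · exact Or.inr ⟨hg.uniq u h2 v hv h4 hyv (hno u h2 h3 h4) (hno v hv hvx hyv), h1⟩
      · left
        intro u w hR
        rcases key u w hR with ⟨h1, h2, h3, h4⟩ | ⟨h1, h2, h3, h4⟩
        · exact hv ⟨w, h2, h3, h4⟩
        · exact hv ⟨u, h2, h3, h4⟩
  · push Not at hE
    obtain ⟨u, hu, v, hv, huv⟩ := Finset.one_lt_card.1 hc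
    have hadj := hI.adj_contract huv hu ?_
    · refine ⟨u, hu, v, hv, huv, hadj, Or.inl ?_⟩
      intro a b hR
      have h0 := (hadj a b).1 (Or.inr hR)
      exact hE a (Finset.mem_of_mem_erase h0.1) b (Finset.mem_of_mem_erase h0.2.1) h0.2.2
    · intro w hw _ h1
      exact absurd h1 (hE v hv w hw)

lemma TInv.exists_seq [DecidableEq V] (h : NoBad G) (n : ℕ) : ∀ {H : Trigraph V}, TInv G H →
    H.verts.card = n + 1 →
    ∃ L : List (V × V), H.ValidSeq L ∧ (H.applySeq L).verts.card = 1 ∧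
    ∀ L' : List (V × V), L' <+: L → ∀ v, (H.applySeq L').redDeg v ≤ 1 := by
  induction n with
  | zero =>
    intro H hI hc
    refine ⟨[], trivial, by simpa [Trigraph.applySeq] using hc, ?_⟩
    intro L' hL' v
    rw [List.prefix_nil] at hL'
    subst hL'
    exact hI.redDeg v
  | succ n ih =>
    intro H hI hc
    obtain ⟨u, hu, v, hv, huv, hI'⟩ := hI.step h (by omega)
    have hc' : (H.contract u v).verts.card = n + 1 := by
      show (H.verts.erase v).card = n + 1
      rw [Finset.card_erase_of_mem hv]; omega
    obtain ⟨L, hL1, hL2, hL3⟩ := ih hI' hc'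
    refine ⟨(u, v) :: L, ⟨hu, hv, huv, hL1⟩, hL2, ?_⟩
    intro L' hL' w
    rcases L' with _ | ⟨p, L''⟩
    · exact hI.redDeg w
    · rw [List.cons_prefix_cons] at hL'
      obtain ⟨rfl, hL''⟩ := hL'
      exact hL3 L'' hL'' w

/-- an induced path on four vertices, black edges -/
def HasP4 (H : Trigraph V) : Prop := ∃ a b c d, H.Black a b ∧ H.Black b c ∧ H.Black c d ∧
  ¬ H.Black a c ∧ ¬ H.Black b d ∧ ¬ H.Black a d

lemma HasP4.contract [DecidableEq V] {H : Trigraph V} {u v : V} (hP : HasP4 H)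
    (hu : u ∈ H.verts) (huv : u ≠ v)
    (hR : ∀ x y, ¬ (H.contract u v).Red x y) : HasP4 (H.contract u v) := by
  have tw : ∀ y, y ≠ u → y ≠ v → (H.Black u y ↔ H.Black v y) := by
    intro y hyu hyv
    by_contra hne
    have hy : y ∈ H.verts := by
      by_contra hy
      apply hne
      constructor
      · intro hh; exact absurd (H.black_mem _ _ (H.black_symm _ _ hh)) hy
      · intro hh; exact absurd (H.black_mem _ _ (H.black_symm _ _ hh)) hy
    refine hR u y ⟨Finset.mem_erase.2 ⟨huv, hu⟩, Finset.mem_erase.2 ⟨hyv, hy⟩, hyu.symm,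
      Or.inl ⟨rfl, ?_, ?_⟩⟩
    · unfold Trigraph.Adj; tauto
    · tauto
  let π : V → V := fun x => if x = v then u else x
  have hB : ∀ x y, ¬ (x = u ∧ y = v) → ¬ (x = v ∧ y = u) → x ≠ y →
      ((H.contract u v).Black (π x) (π y) ↔ H.Black x y) := by
    intro x y h1 h2 h3
    have hbs := H.black_symm
    have hbm := H.black_mem
    have hbn := H.black_ne
    simp only [Trigraph.contract, Finset.mem_erase, π]
    by_cases hx : x = v
    · have hy : y ≠ v := fun hh => h3 (hx.trans hh.symm)
      have hyu : y ≠ u := fun hh => h2 ⟨hx, hh⟩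
      subst hx
      have := tw y hyu hy
      simp only [if_true, if_neg hy]
      grind
    · by_cases hy : y = v
      · have hxu : x ≠ u := fun hh => h1 ⟨hh, hy⟩
        subst hy
        have := tw x hxu hx
        simp only [if_true, if_neg hx]
        grind
      · simp only [if_neg hx, if_neg hy]
        by_cases hxu : x = u
        · subst hxu
          have := tw y h3.symm hy
          grind
        · by_cases hyu : y = u
          · subst hyu
            have := tw x h3 hx
            grind
          · grind
  obtain ⟨a, b, c, d, h1, h2, h3, h4, h5, h6⟩ := hP
  have hbs := H.black_symm
  have n1 := H.black_ne _ _ h1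
  have n2 := H.black_ne _ _ h2
  have n3 := H.black_ne _ _ h3
  have n4 : a ≠ c := by rintro rfl; exact h6 h3
  have n5 : b ≠ d := by rintro rfl; exact h6 h1
  have n6 : a ≠ d := by rintro rfl; exact h5 (hbs _ _ h1)
  refine ⟨π a, π b, π c, π d, ?_, ?_, ?_, ?_, ?_, ?_⟩
  all_goals rw [hB _ _ ?_ ?_ (by assumption)]
  all_goals first | assumption | skip
  all_goals
    rintro ⟨rfl, rfl⟩
    have ta := tw a
    have tb := tw b
    have tc := tw c
    have td := tw d
    grind

lemma no_zero_seq [DecidableEq V] [Finite V] : ∀ (L : List (V × V)) (H : Trigraph V), HasP4 H →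
    H.ValidSeq L → (H.applySeq L).verts.card = 1 →
    (∀ L' : List (V × V), L' <+: L → ∀ v, (H.applySeq L').redDeg v ≤ 0) → False := by
  intro L
  induction L with
  | nil =>
    rintro H ⟨a, b, c, d, h1, h2, h3, h4, h5, h6⟩ _ hc _
    have hc : H.verts.card = 1 := hc
    obtain ⟨w, hw⟩ := Finset.card_eq_one.1 hc
    have ha := H.black_mem _ _ h1
    have hb := H.black_mem _ _ h2
    rw [hw, Finset.mem_singleton] at ha hb
    exact H.black_ne _ _ h1 (ha.trans hb.symm)
  | cons p L ih =>
    intro H hP hV hc hr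
    obtain ⟨h1, h2, h3, h4⟩ := hV
    refine ih (H.contract p.1 p.2) (hP.contract h1 h3 ?_) h4 hc ?_
    · intro x y hR
      have h0 := hr [p] (by simp) x
      have h0 : (H.contract p.1 p.2).redDeg x ≤ 0 := h0
      unfold Trigraph.redDeg at h0
      rw [Nat.le_zero, Set.ncard_eq_zero (Set.toFinite _)] at h0
      have : y ∈ ({w | (H.contract p.1 p.2).Red x w} : Set V) := hR
      rw [h0] at this
      exact this
    · intro L' hL' v
      exact hr (p :: L') (by simpa [List.cons_prefix_cons] using hL') v

lemma tww_eq_one [DecidableEq V] [Fintype V] (h : NoBad G) {a b c d : V} (h1 : G.Adj a b)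
    (h2 : G.Adj b c) (h3 : G.Adj c d) (n1 : a ≠ c) (n2 : b ≠ d) : G.tww = 1 := by
  have hI : TInv G G.toTrigraph := by
    refine ⟨?_, Or.inl fun _ _ hh => hh⟩
    intro u w
    simp [Trigraph.Adj, SimpleGraph.toTrigraph]
  have hcard : G.toTrigraph.verts.card = (Fintype.card V - 1) + 1 := by
    have : 0 < Fintype.card V := Fintype.card_pos_iff.2 ⟨a⟩
    show Fintype.card V = _
    omega
  have hmem := TInv.exists_seq h _ hI hcard
  have hP : HasP4 G.toTrigraph := by
    refine ⟨a, b, c, d, h1, h2, h3, ?_, ?_, ?_⟩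
    · exact fun hh => h.h3 h1 h2 hh
    · exact fun hh => h.h3 h2 h3 hh
    · exact fun hh => h.h4 h1 h2 h3 hh n1 n2
  unfold SimpleGraph.tww Trigraph.tww
  apply le_antisymm
  · exact Nat.sInf_le hmem
  · rw [Nat.one_le_iff_ne_zero]
    intro h0
    have := Nat.sInf_mem (s := {d : ℕ | ∃ L : List (V × V), G.toTrigraph.ValidSeq L ∧
      (G.toTrigraph.applySeq L).verts.card = 1 ∧
      ∀ L' : List (V × V), L' <+: L → ∀ v, (G.toTrigraph.applySeq L').redDeg v ≤ d}) ⟨1, hmem⟩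
    rw [h0] at this
    obtain ⟨L, hL1, hL2, hL3⟩ := this
    exact no_zero_seq L _ hP hL1 hL2 hL3

end det

section prob
open Finset Classical

/-- weight of a graph -/
noncomputable def wt (n : ℕ) (p : ℝ) (G : SimpleGraph (Fin n)) : ℝ :=
  p ^ G.edgeSet.ncard * (1 - p) ^ (n.choose 2 - G.edgeSet.ncard)

lemma wt_nonneg {n : ℕ} {p : ℝ} (h0 : 0 ≤ p) (h1 : p ≤ 1) (G : SimpleGraph (Fin n)) :
    0 ≤ wt n p G :=
  mul_nonneg (pow_nonneg h0 _) (pow_nonneg (by linarith) _)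

lemma erProb_eq (n : ℕ) (p : ℝ) (A : Set (SimpleGraph (Fin n))) :
    erProb n p A = ∑ G : SimpleGraph (Fin n), if G ∈ A then wt n p G else 0 := by
  unfold erProb
  rw [finsum_mem_def, finsum_eq_sum_of_fintype]
  refine Finset.sum_congr rfl fun G _ => ?_
  rw [Set.indicator_apply]
  rfl

lemma sum_edges (n : ℕ) (p : ℝ) (E : Finset (Sym2 (Fin n))) (hE : ∀ e ∈ E, ¬ e.IsDiag) :
    (∑ G : SimpleGraph (Fin n), if (E : Set (Sym2 (Fin n))) ⊆ G.edgeSet then wt n p G else 0)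
      = p ^ E.card := by
  set K : Finset (Sym2 (Fin n)) := (⊤ : SimpleGraph (Fin n)).edgeFinset with hK
  have hKc : K.card = n.choose 2 := by
    rw [hK, SimpleGraph.card_edgeFinset_top_eq_card_choose_two, Fintype.card_fin]
  have hKm : ∀ e, e ∈ K ↔ ¬ e.IsDiag := by
    intro e
    rw [hK, SimpleGraph.mem_edgeFinset, SimpleGraph.edgeSet_top]
    simp
  have hEK : E ⊆ K := fun e he => (hKm e).2 (hE e he)
  rw [← Finset.sum_filter]
  have h1 : (p + (1 - p)) ^ (K \ E).card = 1 := by simp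
  rw [← mul_one (p ^ E.card), ← h1, ← Finset.sum_pow_mul_eq_add_pow, Finset.mul_sum]
  refine Finset.sum_bij' (fun G _ => G.edgeFinset \ E)
    (fun T _ => SimpleGraph.fromEdgeSet ((T ∪ E : Finset (Sym2 (Fin n))) : Set (Sym2 (Fin n))))
    ?_ ?_ ?_ ?_ ?_
  · intro G hG
    rw [Finset.mem_powerset]
    apply Finset.sdiff_subset_sdiff _ (le_refl _)
    intro e he
    exact (hKm e).2 (G.not_isDiag_of_mem_edgeSet (SimpleGraph.mem_edgeFinset.1 he))
  · intro T hT
    rw [Finset.mem_filter]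
    refine ⟨Finset.mem_univ _, ?_⟩
    rw [SimpleGraph.edgeSet_fromEdgeSet]
    intro e he
    refine ⟨by simp only [Finset.coe_union]; exact Or.inr he, ?_⟩
    simpa using hE e he
  · intro G hG
    have hG := (Finset.mem_filter.1 hG).2
    have : ((G.edgeFinset \ E ∪ E : Finset (Sym2 (Fin n))) : Set (Sym2 (Fin n))) = G.edgeSet := by
      ext e
      have := @hG e
      simp only [Finset.coe_union, Finset.coe_sdiff, SimpleGraph.coe_edgeFinset, Set.mem_union,
        Set.mem_sdiff]
      tauto
    simp only [this, SimpleGraph.fromEdgeSet_edgeSet]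
  · intro T hT
    have hT := Finset.mem_powerset.1 hT
    ext e
    have h2 := @hT e
    have h3 := hKm e
    have h4 := @hEK e
    simp only [Finset.mem_sdiff, SimpleGraph.mem_edgeFinset, SimpleGraph.edgeSet_fromEdgeSet,
      Set.mem_sdiff, Finset.coe_union, Set.mem_union, Finset.mem_coe] at *
    have h5 : e ∈ Sym2.diagSet ↔ e.IsDiag := by simp
    tauto
  · intro G hG
    have hG := (Finset.mem_filter.1 hG).2
    have hEG : E ⊆ G.edgeFinset := fun e he => SimpleGraph.mem_edgeFinset.2 (hG he)
    have hGK : G.edgeFinset ⊆ K := fun e he =>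
      (hKm e).2 (G.not_isDiag_of_mem_edgeSet (SimpleGraph.mem_edgeFinset.1 he))
    have hn : G.edgeSet.ncard = G.edgeFinset.card := by
      rw [← SimpleGraph.coe_edgeFinset, Set.ncard_coe_finset]
    have c1 := Finset.card_le_card hEG
    have c2 := Finset.card_le_card hGK
    rw [wt, hn, Finset.card_sdiff_of_subset hEG, Finset.card_sdiff_of_subset hEK, ← hKc,
      ← mul_assoc, ← pow_add]
    congr 2 <;> omega

lemma sum_wt (n : ℕ) (p : ℝ) : ∑ G : SimpleGraph (Fin n), wt n p G = 1 := by
  simpa using sum_edges n p ∅ (by simp)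

lemma erProb_le_one {n : ℕ} {p : ℝ} (h0 : 0 ≤ p) (h1 : p ≤ 1) (A : Set (SimpleGraph (Fin n))) :
    erProb n p A ≤ 1 := by
  rw [erProb_eq, ← sum_wt n p]
  refine Finset.sum_le_sum fun G _ => ?_
  have := wt_nonneg h0 h1 G
  split_ifs <;> linarith

lemma erProb_copy_le {n k : ℕ} {p : ℝ} (h0 : 0 ≤ p) (h1 : p ≤ 1) (E : Finset (Fin k × Fin k))
    (hE : ∀ e ∈ E, e.1 < e.2) :
    erProb n p {G | HasCopy E G} ≤ (n : ℝ) ^ k * p ^ E.card := by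
  let im : (Fin k → Fin n) → Finset (Sym2 (Fin n)) := fun f => E.image (fun e => s(f e.1, f e.2))
  have hle : erProb n p {G | HasCopy E G} ≤ ∑ G : SimpleGraph (Fin n),
      ∑ f ∈ (Finset.univ : Finset (Fin k → Fin n)).filter Function.Injective,
        if ((im f : Finset (Sym2 (Fin n))) : Set (Sym2 (Fin n))) ⊆ G.edgeSet then wt n p G else 0 := by
    rw [erProb_eq]
    refine Finset.sum_le_sum fun G _ => ?_
    have hnn : ∀ f ∈ (Finset.univ : Finset (Fin k → Fin n)).filter Function.Injective,
        0 ≤ if ((im f : Finset (Sym2 (Fin n))) : Set (Sym2 (Fin n))) ⊆ G.edgeSet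
          then wt n p G else 0 := by
      intro f _
      have := wt_nonneg h0 h1 G
      split_ifs <;> linarith
    by_cases hG : HasCopy E G
    · rw [if_pos (by exact hG)]
      obtain ⟨f, hf, hfE⟩ := hG
      refine le_trans ?_ (Finset.single_le_sum hnn (Finset.mem_filter.2 ⟨Finset.mem_univ f, hf⟩))
      rw [if_pos]
      intro e he
      simp only [im, Finset.coe_image, Set.mem_image, Finset.mem_coe] at he
      obtain ⟨x, hx, rfl⟩ := he
      exact hfE x hx
    · rw [if_neg (by exact hG)]
      exact Finset.sum_nonneg hnn
  refine hle.trans ?_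
  rw [Finset.sum_comm]
  have hval : ∀ f ∈ (Finset.univ : Finset (Fin k → Fin n)).filter Function.Injective,
      (∑ G : SimpleGraph (Fin n), if ((im f : Finset (Sym2 (Fin n))) : Set (Sym2 (Fin n)))
        ⊆ G.edgeSet then wt n p G else 0) = p ^ E.card := by
    intro f hf
    have hf := (Finset.mem_filter.1 hf).2
    rw [sum_edges]
    · congr 1
      apply Finset.card_image_of_injOn
      intro x hx y hy hxy
      simp only [Sym2.eq_iff] at hxy
      have h1 := hE x hx
      have h2 := hE y hy
      rcases hxy with ⟨h3, h4⟩ | ⟨h3, h4⟩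
      · exact Prod.ext (hf h3) (hf h4)
      · rw [hf h3, hf h4] at h1
        exact absurd h1 (not_lt.2 h2.le)
    · intro e he
      simp only [im, Finset.mem_image] at he
      obtain ⟨x, hx, rfl⟩ := he
      rw [Sym2.mk_isDiag_iff]
      exact fun hh => (hE x hx).ne (hf hh)
  rw [Finset.sum_congr rfl hval, Finset.sum_const, nsmul_eq_mul]
  apply mul_le_mul_of_nonneg_right _ (pow_nonneg h0 _)
  have := Finset.card_le_card (Finset.filter_subset Function.Injective
    (Finset.univ : Finset (Fin k → Fin n)))
  rw [Finset.card_univ, Fintype.card_fun, Fintype.card_fin, Fintype.card_fin] at this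
  exact_mod_cast this

lemma delta_sum {m : ℕ} (x : Fin m) (u w : ℝ) :
    ∑ y : Fin m, (u + if x = y then w else 0) = m * u + w := by
  rw [Finset.sum_add_distrib]
  simp

lemma pow_card_pair {α : Type*} [DecidableEq α] (x y : α) {p : ℝ} (_ : 0 ≤ p) :
    p ^ ({x, y} : Finset α).card ≤ p ^ 2 + if x = y then p else 0 := by
  by_cases h : x = y
  · subst h
    simp
    positivity
  · rw [Finset.card_pair h]; simp [h]

/-- existence of a path on four vertices -/
def P4 {V : Type*} (G : SimpleGraph V) : Prop :=
  ∃ a b c d, G.Adj a b ∧ G.Adj b c ∧ G.Adj c d ∧ a ≠ c ∧ b ≠ d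

lemma second_sum {m : ℕ} (p : ℝ) :
    ∑ t : Fin m × Fin m × Fin m × Fin m, ∑ t' : Fin m × Fin m × Fin m × Fin m,
      ((p ^ 2 + if t.1 = t'.1 ∧ t.2.1 = t'.2.1 then p else 0) *
      (p ^ 2 + if t.2.1 = t'.2.1 ∧ t.2.2.1 = t'.2.2.1 then p else 0) *
      (p ^ 2 + if t.2.2.1 = t'.2.2.1 ∧ t.2.2.2 = t'.2.2.2 then p else 0)) =
    (m : ℝ) ^ 4 * (m ^ 4 * p ^ 6 + 3 * m ^ 2 * p ^ 5 + 2 * m * p ^ 4 + p ^ 4 + p ^ 3) := by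
  have inner : ∀ t : Fin m × Fin m × Fin m × Fin m, ∑ t' : Fin m × Fin m × Fin m × Fin m,
      ((p ^ 2 + if t.1 = t'.1 ∧ t.2.1 = t'.2.1 then p else 0) *
      (p ^ 2 + if t.2.1 = t'.2.1 ∧ t.2.2.1 = t'.2.2.1 then p else 0) *
      (p ^ 2 + if t.2.2.1 = t'.2.2.1 ∧ t.2.2.2 = t'.2.2.2 then p else 0)) =
      (m ^ 4 * p ^ 6 + 3 * m ^ 2 * p ^ 5 + 2 * m * p ^ 4 + p ^ 4 + p ^ 3) := by
    rintro ⟨a, b, c, d⟩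
    simp only [Fintype.sum_prod_type]
    have s1 : ∀ c', ∑ d' : Fin m, (p ^ 2 + if c = c' ∧ d = d' then p else 0)
        = m * p ^ 2 + if c = c' then p else 0 := by
      intro c'
      by_cases hc : c = c'
      · simp only [hc, true_and, if_true]; exact delta_sum _ _ _
      · simp [hc]
    have s2 : ∀ b', ∑ c' : Fin m, ((p ^ 2 + if b = b' ∧ c = c' then p else 0) *
        (m * p ^ 2 + if c = c' then p else 0)) =
        (m ^ 2 * p ^ 4 + p ^ 3) + if b = b' then (m * p ^ 3 + p ^ 2) else 0 := by
      intro b'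
      have : ∀ c' : Fin m, ((p ^ 2 + if b = b' ∧ c = c' then p else 0) *
        (m * p ^ 2 + if c = c' then p else 0)) = m * p ^ 4 + if c = c' then
          (p ^ 3 + if b = b' then (m * p ^ 3 + p ^ 2) else 0) else 0 := by
        intro c'
        by_cases hc : c = c' <;> by_cases hb : b = b' <;> simp [hc, hb] <;> ring
      rw [Finset.sum_congr rfl fun c' _ => this c', delta_sum]
      ring
    have s3 : ∀ a', ∑ b' : Fin m, ((p ^ 2 + if a = a' ∧ b = b' then p else 0) *
        ((m ^ 2 * p ^ 4 + p ^ 3) + if b = b' then (m * p ^ 3 + p ^ 2) else 0)) =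
        (m * p ^ 2 * (m ^ 2 * p ^ 4 + p ^ 3) + p ^ 2 * (m * p ^ 3 + p ^ 2)) + if a = a' then
          (p * (m ^ 2 * p ^ 4 + p ^ 3) + p * (m * p ^ 3 + p ^ 2)) else 0 := by
      intro a'
      have : ∀ b' : Fin m, ((p ^ 2 + if a = a' ∧ b = b' then p else 0) *
        ((m ^ 2 * p ^ 4 + p ^ 3) + if b = b' then (m * p ^ 3 + p ^ 2) else 0)) =
          p ^ 2 * (m ^ 2 * p ^ 4 + p ^ 3) + if b = b' then
          (p ^ 2 * (m * p ^ 3 + p ^ 2) + if a = a' then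
          (p * (m ^ 2 * p ^ 4 + p ^ 3) + p * (m * p ^ 3 + p ^ 2)) else 0) else 0 := by
        intro b'
        by_cases hc : a = a' <;> by_cases hb : b = b' <;> simp [hc, hb] <;> ring
      rw [Finset.sum_congr rfl fun c' _ => this c', delta_sum]
      ring
    have t1 : ∀ a' b' c', ∑ d' : Fin m, ((p ^ 2 + if a = a' ∧ b = b' then p else 0) *
        (p ^ 2 + if b = b' ∧ c = c' then p else 0) *
        (p ^ 2 + if c = c' ∧ d = d' then p else 0)) =
        (p ^ 2 + if a = a' ∧ b = b' then p else 0) *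
        ((p ^ 2 + if b = b' ∧ c = c' then p else 0) * (m * p ^ 2 + if c = c' then p else 0)) := by
      intro a' b' c'
      rw [← Finset.mul_sum, s1, mul_assoc]
    have t2 : ∀ a' b', ∑ c' : Fin m, ((p ^ 2 + if a = a' ∧ b = b' then p else 0) *
        ((p ^ 2 + if b = b' ∧ c = c' then p else 0) * (m * p ^ 2 + if c = c' then p else 0))) =
        (p ^ 2 + if a = a' ∧ b = b' then p else 0) *
        ((m ^ 2 * p ^ 4 + p ^ 3) + if b = b' then (m * p ^ 3 + p ^ 2) else 0) := by
      intro a' b'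
      rw [← Finset.mul_sum, s2]
    simp only [t1, t2, s3, delta_sum]
    ring
  rw [Finset.sum_congr rfl fun t _ => inner t, Finset.sum_const, nsmul_eq_mul]
  congr 1
  simp
  ring

lemma second_moment {n m : ℕ} (hm : 4 * m ≤ n) {p : ℝ} (h0 : 0 ≤ p) (h1 : p ≤ 1) :
    ((m : ℝ) ^ 4 * p ^ 3) ^ 2 ≤ erProb n p {G | P4 G} *
      ((m : ℝ) ^ 4 * (m ^ 4 * p ^ 6 + 3 * m ^ 2 * p ^ 5 + 2 * m * p ^ 4 + p ^ 4 + p ^ 3)) := by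
  let em : Fin 4 → Fin m → Fin n := fun i a => ⟨i * m + a, by
    have := a.2
    have hi : (i : ℕ) ≤ 3 := by omega
    nlinarith⟩
  have em_inj : ∀ i j a b, em i a = em j b ↔ i = j ∧ a = b := by
    intro i j a b
    constructor
    · intro h
      have h : (i : ℕ) * m + a = j * m + b := by simpa [em] using h
      have ha := a.2
      have hb := b.2
      have hij : (i : ℕ) = j := by
        rcases lt_trichotomy (i : ℕ) j with hlt | heq | hlt
        · nlinarith
        · exact heq
        · nlinarith
      refine ⟨Fin.ext hij, Fin.ext ?_⟩
      rw [hij] at h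
      omega
    · rintro ⟨rfl, rfl⟩; rfl
  let e1 : Fin m × Fin m × Fin m × Fin m → Sym2 (Fin n) := fun t => s(em 0 t.1, em 1 t.2.1)
  let e2 : Fin m × Fin m × Fin m × Fin m → Sym2 (Fin n) := fun t => s(em 1 t.2.1, em 2 t.2.2.1)
  let e3 : Fin m × Fin m × Fin m × Fin m → Sym2 (Fin n) := fun t => s(em 2 t.2.2.1, em 3 t.2.2.2)
  have d1 : ∀ t, ¬ (e1 t).IsDiag := by intro t; simp [e1, em_inj]
  have d2 : ∀ t, ¬ (e2 t).IsDiag := by intro t; simp [e2, em_inj]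
  have d3 : ∀ t, ¬ (e3 t).IsDiag := by intro t; simp [e3, em_inj]
  have q1 : ∀ t t', e1 t = e1 t' ↔ t.1 = t'.1 ∧ t.2.1 = t'.2.1 := by
    intro t t'; simp [e1, em_inj]
  have q2 : ∀ t t', e2 t = e2 t' ↔ t.2.1 = t'.2.1 ∧ t.2.2.1 = t'.2.2.1 := by
    intro t t'; simp [e2, em_inj]
  have q3 : ∀ t t', e3 t = e3 t' ↔ t.2.2.1 = t'.2.2.1 ∧ t.2.2.2 = t'.2.2.2 := by
    intro t t'; simp [e3, em_inj]
  have n12 : ∀ t t', e1 t ≠ e2 t' := by intro t t'; simp [e1, e2, em_inj]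
  have n13 : ∀ t t', e1 t ≠ e3 t' := by intro t t'; simp [e1, e3, em_inj]
  have n23 : ∀ t t', e2 t ≠ e3 t' := by intro t t'; simp [e2, e3, em_inj]
  let Es : Fin m × Fin m × Fin m × Fin m → Finset (Sym2 (Fin n)) := fun t => {e1 t, e2 t, e3 t}
  have hEs : ∀ t, ∀ e ∈ Es t, ¬ e.IsDiag := by
    intro t e he
    simp only [Es, Finset.mem_insert, Finset.mem_singleton] at he
    rcases he with rfl | rfl | rfl
    · exact d1 t
    · exact d2 t
    · exact d3 t
  have hEc : ∀ t, (Es t).card = 3 := by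
    intro t
    exact Finset.card_eq_three.2 ⟨_, _, _, n12 t t, n13 t t, n23 t t, rfl⟩
  let ind : Fin m × Fin m × Fin m × Fin m → SimpleGraph (Fin n) → ℝ := fun t G =>
    if (Es t : Set (Sym2 (Fin n))) ⊆ G.edgeSet then 1 else 0
  let X : SimpleGraph (Fin n) → ℝ := fun G => ∑ t, ind t G
  have EX : ∑ G, wt n p G * X G = (m : ℝ) ^ 4 * p ^ 3 := by
    simp only [X, Finset.mul_sum]
    rw [Finset.sum_comm]
    have : ∀ t, ∑ G, wt n p G * ind t G = p ^ 3 := by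
      intro t
      rw [← hEc t, ← sum_edges n p (Es t) (hEs t)]
      refine Finset.sum_congr rfl fun G _ => ?_
      simp only [ind, mul_ite, mul_one, mul_zero]
    rw [Finset.sum_congr rfl fun t _ => this t, Finset.sum_const, nsmul_eq_mul]
    congr 1
    simp
    ring
  have EXX : ∑ G, wt n p G * X G ^ 2 ≤
      ((m : ℝ) ^ 4 * (m ^ 4 * p ^ 6 + 3 * m ^ 2 * p ^ 5 + 2 * m * p ^ 4 + p ^ 4 + p ^ 3)) := by
    rw [← second_sum p]
    have : ∀ G, wt n p G * X G ^ 2 = ∑ t, ∑ t', wt n p G * (ind t G * ind t' G) := by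
      intro G
      rw [pow_two]
      simp only [X]
      rw [Finset.sum_mul_sum, Finset.mul_sum]
      simp only [Finset.mul_sum]
    rw [Finset.sum_congr rfl fun G _ => this G, Finset.sum_comm]
    refine Finset.sum_le_sum fun t _ => ?_
    rw [Finset.sum_comm]
    refine Finset.sum_le_sum fun t' _ => ?_
    have h2 : ∑ G, wt n p G * (ind t G * ind t' G) = p ^ (Es t ∪ Es t').card := by
      rw [← sum_edges n p (Es t ∪ Es t')]
      · refine Finset.sum_congr rfl fun G _ => ?_
        simp only [ind, Finset.coe_union, Set.union_subset_iff]
        by_cases ha : (Es t : Set (Sym2 (Fin n))) ⊆ G.edgeSet <;>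
          by_cases hb : (Es t' : Set (Sym2 (Fin n))) ⊆ G.edgeSet <;> simp [ha, hb]
      · intro e he
        rcases Finset.mem_union.1 he with he | he
        · exact hEs _ _ he
        · exact hEs _ _ he
    rw [h2]
    have h3 : Es t ∪ Es t' = ({e1 t, e1 t'} ∪ {e2 t, e2 t'}) ∪ {e3 t, e3 t'} := by
      ext e
      simp only [Es, Finset.mem_union, Finset.mem_insert, Finset.mem_singleton]
      tauto
    rw [h3, Finset.card_union_of_disjoint, Finset.card_union_of_disjoint, pow_add, pow_add]
    · have r1 := pow_card_pair (e1 t) (e1 t') h0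
      have r2 := pow_card_pair (e2 t) (e2 t') h0
      have r3 := pow_card_pair (e3 t) (e3 t') h0
      simp only [q1, q2, q3] at r1 r2 r3
      have z : ∀ k, 0 ≤ p ^ k := fun k => pow_nonneg h0 k
      exact mul_le_mul (mul_le_mul r1 r2 (z _) ((z _).trans r1)) r3 (z _)
        (mul_nonneg ((z _).trans r1) ((z _).trans r2))
    · rw [Finset.disjoint_left]
      intro e he he'
      simp only [Finset.mem_insert, Finset.mem_singleton] at he he'
      rcases he with rfl | rfl <;> rcases he' with h | h <;> exact n12 _ _ h
    · rw [Finset.disjoint_left]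
      intro e he he'
      simp only [Finset.mem_union, Finset.mem_insert, Finset.mem_singleton] at he he'
      rcases he with (rfl | rfl) | (rfl | rfl) <;> rcases he' with h | h <;>
        first | exact n13 _ _ h | exact n23 _ _ h
  have hX0 : ∀ G, ¬ P4 G → X G = 0 := by
    intro G hG
    refine Finset.sum_eq_zero fun t _ => ?_
    simp only [ind]
    rw [if_neg]
    intro hsub
    apply hG
    refine ⟨em 0 t.1, em 1 t.2.1, em 2 t.2.2.1, em 3 t.2.2.2, ?_, ?_, ?_, ?_, ?_⟩
    · have : e1 t ∈ G.edgeSet := hsub (by simp [Es])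
      exact this
    · have : e2 t ∈ G.edgeSet := hsub (by simp [Es])
      exact this
    · have : e3 t ∈ G.edgeSet := hsub (by simp [Es])
      exact this
    · simp [em_inj]
    · simp [em_inj]
  have hP : erProb n p {G | P4 G} = ∑ G, (if P4 G then Real.sqrt (wt n p G) else 0) ^ 2 := by
    rw [erProb_eq]
    refine Finset.sum_congr rfl fun G _ => ?_
    by_cases hG : P4 G
    · rw [if_pos hG, if_pos (by exact hG), Real.sq_sqrt (wt_nonneg h0 h1 G)]
    · rw [if_neg hG, if_neg (by exact hG)]; simp
  have hnn : 0 ≤ erProb n p {G | P4 G} := by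
    rw [hP]; exact Finset.sum_nonneg fun _ _ => sq_nonneg _
  refine le_trans ?_ (mul_le_mul_of_nonneg_left EXX hnn)
  rw [← EX, hP]
  have cs := Finset.sum_mul_sq_le_sq_mul_sq (Finset.univ : Finset (SimpleGraph (Fin n)))
    (fun G => if P4 G then Real.sqrt (wt n p G) else 0) (fun G => Real.sqrt (wt n p G) * X G)
  convert cs using 2
  · refine Finset.sum_congr rfl fun G _ => ?_
    by_cases hG : P4 G
    · rw [if_pos hG, ← mul_assoc, Real.mul_self_sqrt (wt_nonneg h0 h1 G)]
    · rw [hX0 G hG]; simp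
  · refine Finset.sum_congr rfl fun G _ => ?_
    rw [mul_pow, Real.sq_sqrt (wt_nonneg h0 h1 G)]

lemma P4_bound {n m : ℕ} (hm : 4 * m ≤ n) {p r : ℝ} (h0 : 0 ≤ p) (h1 : p ≤ 1)
    (hr1 : 1 ≤ r) (hr : r ^ 2 = (m : ℝ) ^ 4 * p ^ 3) : 1 - 7 / r ≤ erProb n p {G | P4 G} := by
  have key := second_moment hm h0 h1
  set P := erProb n p {G | P4 G} with hPdef
  set M : ℝ := (m : ℝ) with hM
  have hM0 : 0 ≤ M := Nat.cast_nonneg m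
  have a1 : r ≤ M ^ 2 * p := by
    apply (sq_le_sq₀ (by linarith) (by positivity)).1
    rw [hr]
    nlinarith [mul_nonneg (mul_nonneg (pow_nonneg hM0 4) (pow_nonneg h0 2)) (sub_nonneg.2 h1)]
  have a2 : r ≤ M ^ 3 * p ^ 2 := by
    apply (sq_le_sq₀ (by linarith) (by positivity)).1
    have : (M ^ 3 * p ^ 2) ^ 2 = r ^ 2 * (M ^ 2 * p) := by rw [hr]; ring
    rw [this]
    nlinarith [sq_nonneg r]
  have a3 : r ≤ M ^ 4 * p ^ 3 := by rw [← hr]; nlinarith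
  have a4 : r ≤ M ^ 4 * p ^ 2 := by
    refine a3.trans ?_
    nlinarith [mul_nonneg (mul_nonneg (pow_nonneg hM0 4) (pow_nonneg h0 2)) (sub_nonneg.2 h1)]
  have hP1 : P ≤ 1 := erProb_le_one h0 h1 _
  have hpos : 0 < (M ^ 4 * p ^ 3) ^ 2 := by rw [← hr]; positivity
  have b : r * (M ^ 4 * (M ^ 4 * p ^ 6 + 3 * M ^ 2 * p ^ 5 + 2 * M * p ^ 4 + p ^ 4 + p ^ 3)) ≤
      (M ^ 4 * p ^ 3) ^ 2 * (r + 7) := by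
    have c1 := mul_le_mul_of_nonneg_left a1 (show 0 ≤ M ^ 6 * p ^ 5 by positivity)
    have c2 := mul_le_mul_of_nonneg_left a2 (show 0 ≤ M ^ 5 * p ^ 4 by positivity)
    have c3 := mul_le_mul_of_nonneg_left a3 (show 0 ≤ M ^ 4 * p ^ 3 by positivity)
    have c4 := mul_le_mul_of_nonneg_left a4 (show 0 ≤ M ^ 4 * p ^ 4 by positivity)
    nlinarith
  have hPn : 0 ≤ P := by
    by_contra hneg
    push Not at hneg
    have : P * (M ^ 4 * (M ^ 4 * p ^ 6 + 3 * M ^ 2 * p ^ 5 + 2 * M * p ^ 4 + p ^ 4 + p ^ 3)) ≤ 0 :=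
      mul_nonpos_of_nonpos_of_nonneg hneg.le (by positivity)
    linarith
  have e : r ≤ P * (r + 7) := by
    have f1 := mul_le_mul_of_nonneg_left b hPn
    have f2 := mul_le_mul_of_nonneg_left key (show 0 ≤ r by linarith)
    have f3 : (M ^ 4 * p ^ 3) ^ 2 * r ≤ (M ^ 4 * p ^ 3) ^ 2 * (P * (r + 7)) := by
      nlinarith
    exact le_of_mul_le_mul_left f3 hpos
  have hr0 : 0 < r := by linarith
  have : r * (1 - 7 / r) ≤ r * P := by
    rw [mul_sub, mul_div_cancel₀ _ hr0.ne']
    nlinarith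
  exact le_of_mul_le_mul_left this hr0

lemma main_bound {n : ℕ} {p r : ℝ} (h0 : 0 ≤ p) (h1 : p ≤ 1)
    (hr1 : 1 ≤ r) (hr : r ^ 2 = ((n / 4 : ℕ) : ℝ) ^ 4 * p ^ 3) :
    1 - 7 / r - ((n * p) ^ 3 + (n * p) ^ 4 + (n * p) ^ 5 + (n * p) ^ 6 + 2 * (n ^ 7 * p ^ 6)) ≤
      erProb n p {G | G.tww = 1} := by
  have hP := P4_bound (n := n) (m := n / 4) (by omega) h0 h1 hr1 hr
  have b3 := erProb_copy_le (n := n) h0 h1 patC3 (by decide)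
  have b4 := erProb_copy_le (n := n) h0 h1 patC4 (by decide)
  have b5 := erProb_copy_le (n := n) h0 h1 patC5 (by decide)
  have b6 := erProb_copy_le (n := n) h0 h1 patC6 (by decide)
  have b7 := erProb_copy_le (n := n) h0 h1 patP7 (by decide)
  have b8 := erProb_copy_le (n := n) h0 h1 patS7 (by decide)
  rw [show patC3.card = 3 by decide] at b3
  rw [show patC4.card = 4 by decide] at b4
  rw [show patC5.card = 5 by decide] at b5
  rw [show patC6.card = 6 by decide] at b6
  rw [show patP7.card = 6 by decide] at b7
  rw [show patS7.card = 6 by decide] at b8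
  have hsum : erProb n p {G | P4 G} ≤ erProb n p {G | G.tww = 1} +
      (erProb n p {G | HasCopy patC3 G} + erProb n p {G | HasCopy patC4 G} +
      erProb n p {G | HasCopy patC5 G} + erProb n p {G | HasCopy patC6 G} +
      erProb n p {G | HasCopy patP7 G} + erProb n p {G | HasCopy patS7 G}) := by
    simp only [erProb_eq, ← Finset.sum_add_distrib]
    refine Finset.sum_le_sum fun G _ => ?_
    have hw := wt_nonneg h0 h1 G
    have hn : ∀ A : Set (SimpleGraph (Fin n)), 0 ≤ if G ∈ A then wt n p G else 0 := by
      intro A; split_ifs <;> linarith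
    have m1 := hn {G | HasCopy patC3 G}
    have m2 := hn {G | HasCopy patC4 G}
    have m3 := hn {G | HasCopy patC5 G}
    have m4 := hn {G | HasCopy patC6 G}
    have m5 := hn {G | HasCopy patP7 G}
    have m6 := hn {G | HasCopy patS7 G}
    have m7 := hn {G | G.tww = 1}
    by_cases hG : P4 G
    · rw [if_pos (show G ∈ {G | P4 G} from hG)]
      by_cases hb : NoBad G
      · obtain ⟨a, b, c, d, g1, g2, g3, g4, g5⟩ := hG
        have ht : G ∈ {G : SimpleGraph (Fin n) | G.tww = 1} := by
          show G.tww = 1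
          convert tww_eq_one hb g1 g2 g3 g4 g5
        rw [if_pos ht]
        linarith
      · have hor : HasCopy patC3 G ∨ HasCopy patC4 G ∨ HasCopy patC5 G ∨ HasCopy patC6 G ∨
            HasCopy patP7 G ∨ HasCopy patS7 G := by
          by_contra hcon
          push Not at hcon
          exact hb ⟨hcon.1, hcon.2.1, hcon.2.2.1, hcon.2.2.2.1, hcon.2.2.2.2.1, hcon.2.2.2.2.2⟩
        rcases hor with hc | hc | hc | hc | hc | hc
        · rw [if_pos (show G ∈ {G | HasCopy patC3 G} from hc)] at *; linarith
        · rw [if_pos (show G ∈ {G | HasCopy patC4 G} from hc)] at *; linarith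
        · rw [if_pos (show G ∈ {G | HasCopy patC5 G} from hc)] at *; linarith
        · rw [if_pos (show G ∈ {G | HasCopy patC6 G} from hc)] at *; linarith
        · rw [if_pos (show G ∈ {G | HasCopy patP7 G} from hc)] at *; linarith
        · rw [if_pos (show G ∈ {G | HasCopy patS7 G} from hc)] at *; linarith
    · rw [if_neg (show ¬ G ∈ {G | P4 G} from hG)]
      linarith
  simp only [mul_pow]
  linarith

end prob

/-- **Theorem 5(2).** If `p(n)·n^{4/3} → ∞` and `p(n)·n^{7/6} → 0`, then a.a.s.
`tww(G(n,p)) = 1`. -/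
theorem tww_random_eq_one (p : ℕ → ℝ) (hp01 : ∀ n, p n ∈ Set.Icc (0 : ℝ) 1)
    (hp₁ : Filter.Tendsto (fun n : ℕ => p n * (n : ℝ) ^ ((4 : ℝ) / 3))
      Filter.atTop Filter.atTop)
    (hp₂ : Filter.Tendsto (fun n : ℕ => p n * (n : ℝ) ^ ((7 : ℝ) / 6))
      Filter.atTop (nhds 0)) :
    Filter.Tendsto
      (fun n : ℕ => erProb n (p n) {G : SimpleGraph (Fin n) | G.tww = 1})
      Filter.atTop (nhds 1) := by
  have hnp : Filter.Tendsto (fun n : ℕ => (n : ℝ) * p n) Filter.atTop (nhds 0) := by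
    refine squeeze_zero' (Filter.Eventually.of_forall fun n =>
      mul_nonneg (Nat.cast_nonneg n) (hp01 n).1) ?_ hp₂
    filter_upwards [Filter.eventually_ge_atTop 1] with n hn
    rw [mul_comm]
    apply mul_le_mul_of_nonneg_left _ (hp01 n).1
    have h1 : (1 : ℝ) ≤ n := by exact_mod_cast hn
    calc (n : ℝ) = (n : ℝ) ^ (1 : ℝ) := (Real.rpow_one _).symm
      _ ≤ _ := Real.rpow_le_rpow_of_exponent_le h1 (by norm_num)
  have h7 : Filter.Tendsto (fun n : ℕ => (n : ℝ) ^ 7 * p n ^ 6) Filter.atTop (nhds 0) := by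
    have := hp₂.pow 6
    rw [zero_pow (by norm_num)] at this
    refine this.congr fun n => ?_
    rw [mul_pow, ← Real.rpow_natCast ((n : ℝ) ^ ((7 : ℝ) / 6)) 6, ← Real.rpow_mul (Nat.cast_nonneg n),
      mul_comm]
    congr 1
    rw [← Real.rpow_natCast]
    norm_num
  have ht : Filter.Tendsto (fun n : ℕ => ((n / 4 : ℕ) : ℝ) ^ 4 * p n ^ 3) Filter.atTop
      Filter.atTop := by
    have h3 : Filter.Tendsto (fun n : ℕ => (p n * (n : ℝ) ^ ((4 : ℝ) / 3)) ^ 3 / 4096)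
        Filter.atTop Filter.atTop :=
      ((Filter.tendsto_pow_atTop (by norm_num)).comp hp₁).atTop_div_const (by norm_num)
    refine Filter.tendsto_atTop_mono' _ ?_ h3
    filter_upwards [Filter.eventually_ge_atTop 4] with n hn
    have e1 : (p n * (n : ℝ) ^ ((4 : ℝ) / 3)) ^ 3 = (n : ℝ) ^ 4 * p n ^ 3 := by
      rw [mul_pow, ← Real.rpow_natCast ((n : ℝ) ^ ((4 : ℝ) / 3)) 3,
        ← Real.rpow_mul (Nat.cast_nonneg n), mul_comm]
      congr 1
      rw [← Real.rpow_natCast]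
      norm_num
    have e2 : (n : ℝ) / 8 ≤ ((n / 4 : ℕ) : ℝ) := by
      have : n ≤ 8 * (n / 4) := by omega
      have : (n : ℝ) ≤ 8 * ((n / 4 : ℕ) : ℝ) := by exact_mod_cast this
      linarith
    have e3 : ((n : ℝ) / 8) ^ 4 ≤ ((n / 4 : ℕ) : ℝ) ^ 4 :=
      pow_le_pow_left₀ (by positivity) e2 4
    show (p n * (n : ℝ) ^ ((4 : ℝ) / 3)) ^ 3 / 4096 ≤ ((n / 4 : ℕ) : ℝ) ^ 4 * p n ^ 3
    rw [e1]
    have e4 := mul_le_mul_of_nonneg_right e3 (pow_nonneg (hp01 n).1 3)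
    refine le_trans (le_of_eq ?_) e4
    ring
  have hr : Filter.Tendsto (fun n : ℕ => Real.sqrt (((n / 4 : ℕ) : ℝ) ^ 4 * p n ^ 3)) Filter.atTop
      Filter.atTop := Real.tendsto_sqrt_atTop.comp ht
  have hlow : Filter.Tendsto (fun n : ℕ => 1 - 7 / Real.sqrt (((n / 4 : ℕ) : ℝ) ^ 4 * p n ^ 3) -
      ((n * p n) ^ 3 + (n * p n) ^ 4 + (n * p n) ^ 5 + (n * p n) ^ 6 + 2 * (n ^ 7 * p n ^ 6)))
      Filter.atTop (nhds 1) := by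
    have := ((tendsto_const_nhds (x := (1 : ℝ))).sub (hr.const_div_atTop 7)).sub
      (((((hnp.pow 3).add (hnp.pow 4)).add (hnp.pow 5)).add (hnp.pow 6)).add (h7.const_mul 2))
    simpa using this
  refine tendsto_of_tendsto_of_tendsto_of_le_of_le' hlow tendsto_const_nhds ?_
    (Filter.Eventually.of_forall fun n => erProb_le_one (hp01 n).1 (hp01 n).2 _)
  filter_upwards [hr.eventually_ge_atTop 1] with n hn
  refine main_bound (hp01 n).1 (hp01 n).2 hn (Real.sq_sqrt ?_)
  have := (hp01 n).1
  positivity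
end
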